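/- arXiv:2008.12167 — 2 statements merged into one kernel-verified Lean document; each statement's English description precedes it below -/
import Mathlib

section
/- Under the Poisson approximation standing assumptions, for n ≥ 1 let G_n = CM(d^n) be a configuration-model random multigraph with degree sequence d^n, and set L_n = L(G_n), M_n = M(G_n,h_n), N_n = N(G_n,h_n). Then the total variation distance between the joint distribution of (L_n, M_n, N_n) and the product measure Poi(ν/2) ⊗ Poi(ν²/4) ⊗ Poi(η) tends to 0 as n → ∞, where ν = μ2(p)/μ1(p) − 1 and η = (1/μ1(p))·∑_{i,j≥1} ij·α(i,j), and Poi(λ) denotes the Poisson distribution with mean λ. -/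
open Classical Filter

namespace TWG

/-- Half-edges for the degree sequence `d`: vertex `i` carries `d i` half-edges. -/
abbrev HE {n : ℕ} (d : Fin n → ℕ) := (i : Fin n) × Fin (d i)

/-- A configuration-model pairing: a uniformly random such `M` produces `CM(d)`. -/
def IsMatching {n : ℕ} {d : Fin n → ℕ} (M : HE d → HE d) : Prop :=
  Function.Involutive M ∧ ∀ h, M h ≠ h

/-- `L(G)`: the number of pairs `(ui, uj)`, `i < j`, of half-edges at a common
vertex which are matched in `G` (i.e. the number of loops of `G`). -/
noncomputable def Lcount {n : ℕ} {d : Fin n → ℕ} (M : HE d → HE d) : ℕ :=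
  Nat.card {x : HE d × HE d //
    x.1.1 = x.2.1 ∧ (x.1.2 : ℕ) < (x.2.2 : ℕ) ∧ M x.1 = x.2}

/-- `N(G, H)`: the number of pairs `(ui, vj)` with `uv ∈ e(H)` matched in `G`. -/
noncomputable def Ncount {n : ℕ} {d : Fin n → ℕ} (H : SimpleGraph (Fin n))
    (M : HE d → HE d) : ℕ :=
  Nat.card {x : HE d × HE d // x.1.1 < x.2.1 ∧ H.Adj x.1.1 x.2.1 ∧ M x.1 = x.2}

/-- `M(G, H)`: the number of elements `((ui₁, vj₁), (ui₂, vj₂))` with `u < v`,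
`uv ∉ e(H)`, `i₁ < i₂`, `j₁ ≠ j₂`, both of whose half-edge pairs are matched in `G`. -/
noncomputable def Mcount {n : ℕ} {d : Fin n → ℕ} (H : SimpleGraph (Fin n))
    (M : HE d → HE d) : ℕ :=
  Nat.card {x : (HE d × HE d) × (HE d × HE d) //
    x.1.1.1 = x.2.1.1 ∧ x.1.2.1 = x.2.2.1 ∧ x.1.1.1 < x.1.2.1 ∧
    ¬ H.Adj x.1.1.1 x.1.2.1 ∧
    (x.1.1.2 : ℕ) < (x.2.1.2 : ℕ) ∧ (x.1.2.2 : ℕ) ≠ (x.2.2.2 : ℕ) ∧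
    M x.1.1 = x.1.2 ∧ M x.2.1 = x.2.2}

/-- `μ₁(p) = ∑ k, k⋅p(k)`. -/
noncomputable def mu1 (p : ℕ → ℝ) : ℝ := ∑' k : ℕ, (k : ℝ) * p k

/-- The Poisson probability mass `P(Poi(λ) = k)`. -/
noncomputable def poiP (lam : ℝ) (k : ℕ) : ℝ := Real.exp (-lam) * lam ^ k / k.factorial

set_option linter.unusedSectionVars false

section Filter

/-- `Finset.filter` with classical decidability. -/
noncomputable def fl {α : Type*} (Ω : Finset α) (P : α → Prop) : Finset α := Ω.filter P

lemma mem_fl {α : Type*} {Ω : Finset α} {P : α → Prop} {a : α} : a ∈ fl Ω P ↔ a ∈ Ω ∧ P a := by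
  simp [fl]

lemma fl_eq_empty {α : Type*} {Ω : Finset α} {P : α → Prop} :
    fl Ω P = ∅ ↔ ∀ ⦃a⦄, a ∈ Ω → ¬ P a := by
  simp [fl, Finset.filter_eq_empty_iff]

lemma fl_fl {α : Type*} (P Q : α → Prop) (Ω : Finset α) :
    fl (fl Ω P) Q = fl Ω (fun a => P a ∧ Q a) := by
  ext a; simp only [mem_fl, and_assoc]

lemma sum_fl {α : Type*} (P : α → Prop) [DecidablePred P] (Ω : Finset α) :
    ∑ a ∈ Ω, (if P a then (1 : ℝ) else 0) = (fl Ω P).card := by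
  rw [Finset.sum_boole]; simp only [fl]; congr!

lemma fl_true {α : Type*} (Ω : Finset α) : fl Ω (fun _ => True) = Ω := by
  ext a; simp [mem_fl]

lemma sum_fl_fiber {α β : Type*} [DecidableEq β] {s : Finset α} {t : Finset β} {g : α → β}
    (h : ∀ a ∈ s, g a ∈ t) (f : α → ℝ) :
    ∑ b ∈ t, ∑ a ∈ fl s (fun a => g a = b), f a = ∑ a ∈ s, f a := by
  rw [← Finset.sum_fiberwise_of_maps_to h]
  refine Finset.sum_congr rfl fun b _ => ?_
  refine Finset.sum_congr ?_ fun _ _ => rfl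
  simp only [fl]; congr!

end Filter

section Switching

variable {X : Type*} [Fintype X] [DecidableEq X]

/-- Perfect matchings of `X`, as fixed-point free involutions. -/
def Mt (σ : X → X) : Prop := Function.Involutive σ ∧ ∀ h, σ h ≠ h

/-- Conjugation by a transposition. -/
def cj (y z : X) (σ : X → X) : X → X := fun h => Equiv.swap y z (σ (Equiv.swap y z h))

lemma cj_cj (y z : X) (σ : X → X) : cj y z (cj y z σ) = σ := by
  funext h; simp [cj]

lemma cj_mt {y z : X} {σ : X → X} (h : Mt σ) : Mt (cj y z σ) := by
  refine ⟨fun x => ?_, fun x hx => ?_⟩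
  · simp [cj, h.1 _]
  · have := congrArg (Equiv.swap y z) hx
    simp only [cj, Equiv.swap_apply_self] at this
    exact h.2 _ this

/-- A set of matchings which is determined on `V` and symmetric outside of `V`. -/
structure Sy (V : Finset X) (Ω : Finset (X → X)) : Prop where
  mt : ∀ σ ∈ Ω, Mt σ
  pres : ∀ σ ∈ Ω, ∀ v ∈ V, σ v ∈ V
  conj : ∀ y z, y ∉ V → z ∉ V → ∀ σ ∈ Ω, cj y z σ ∈ Ω

variable {V : Finset X} {Ω : Finset (X → X)}

lemma Sy.filter (h : Sy V Ω) {x y : X} :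
    Sy (insert x (insert y V)) (fl Ω (fun σ => σ x = y)) := by
  refine ⟨fun σ hσ => h.mt σ (mem_fl.1 hσ).1, ?_, ?_⟩
  · intro σ hσ v hv
    obtain ⟨h1, h2⟩ := mem_fl.1 hσ
    simp only [Finset.mem_insert] at hv ⊢
    rcases hv with rfl | rfl | hv
    · exact Or.inr (Or.inl h2)
    · left; rw [← h2]; exact (h.mt σ h1).1 x
    · exact Or.inr (Or.inr (h.pres σ h1 v hv))
  · intro a b ha hb σ hσ
    obtain ⟨h1, h2⟩ := mem_fl.1 hσ
    simp only [Finset.mem_insert, not_or] at ha hb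
    refine mem_fl.2 ⟨h.conj a b ha.2.2 hb.2.2 σ h1, ?_⟩
    simp only [cj]
    rw [Equiv.swap_apply_of_ne_of_ne (Ne.symm ha.1) (Ne.symm hb.1), h2,
      Equiv.swap_apply_of_ne_of_ne (Ne.symm ha.2.1) (Ne.symm hb.2.1)]

lemma Sy.sum (h : Sy V Ω) {x y : X} (hx : x ∉ V) (hy : y ∉ V) (hxy : x ≠ y)
    (f : (X → X) → X → ℝ) :
    ∑ σ ∈ Ω, f (cj (σ x) y σ) (σ x) =
      ∑ τ ∈ fl Ω (fun σ => σ x = y), ∑ z ∈ Finset.univ \ insert x V, f τ z := by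
  rw [Finset.sum_comm]
  have hm : ∀ σ ∈ Ω, σ x ∈ Finset.univ \ insert x V := by
    intro σ hσ
    simp only [Finset.mem_sdiff, Finset.mem_univ, true_and, Finset.mem_insert, not_or]
    refine ⟨(h.mt σ hσ).2 x, fun hv => hx ?_⟩
    have := h.pres σ hσ _ hv
    rwa [(h.mt σ hσ).1 x] at this
  rw [← sum_fl_fiber hm]
  refine Finset.sum_congr rfl fun z hz => ?_
  simp only [Finset.mem_sdiff, Finset.mem_univ, true_and, Finset.mem_insert, not_or] at hz
  refine Finset.sum_nbij' (cj z y) (cj z y) ?_ ?_ ?_ ?_ ?_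
  · intro σ hσ
    obtain ⟨h1, h2⟩ := mem_fl.1 hσ
    refine mem_fl.2 ⟨h.conj _ _ hz.2 hy σ h1, ?_⟩
    simp only [cj]
    rw [Equiv.swap_apply_of_ne_of_ne (Ne.symm hz.1) hxy, h2, Equiv.swap_apply_left]
  · intro σ hσ
    obtain ⟨h1, h2⟩ := mem_fl.1 hσ
    refine mem_fl.2 ⟨h.conj _ _ hz.2 hy σ h1, ?_⟩
    simp only [cj]
    rw [Equiv.swap_apply_of_ne_of_ne (Ne.symm hz.1) hxy, h2, Equiv.swap_apply_right]
  · intro σ _; exact cj_cj _ _ _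
  · intro σ _; exact cj_cj _ _ _
  · intro σ hσ
    rw [(mem_fl.1 hσ).2]

lemma card_sd {x : X} (hx : x ∉ V) :
    ((Finset.univ \ insert x V).card : ℝ) = (Fintype.card X : ℝ) - V.card - 1 := by
  rw [Finset.card_sdiff_of_subset (Finset.subset_univ _), Finset.card_univ, Nat.cast_sub (Finset.card_le_univ _),
    Finset.card_insert_of_notMem hx]
  push_cast; ring

lemma Sy.count (h : Sy V Ω) {x y : X} (hx : x ∉ V) (hy : y ∉ V) (hxy : x ≠ y)
    (Q : (X → X) → Prop) :
    ((fl Ω (fun σ => Q (cj (σ x) y σ))).card : ℝ) =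
      ((Fintype.card X : ℝ) - V.card - 1) *
        ((fl (fl Ω (fun σ => σ x = y)) Q).card : ℝ) := by
  have := h.sum hx hy hxy (fun τ _ => if Q τ then 1 else 0)
  simp only [Finset.sum_const, nsmul_eq_mul, card_sd hx, ← Finset.mul_sum, sum_fl] at this
  exact this

lemma Sy.count' (h : Sy V Ω) {x y : X} (hx : x ∉ V) (hy : y ∉ V) (hxy : x ≠ y) :
    (Ω.card : ℝ) =
      ((Fintype.card X : ℝ) - V.card - 1) * ((fl Ω (fun σ => σ x = y)).card : ℝ) := by
  have := h.count hx hy hxy (fun _ => True)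
  rwa [fl_true, fl_true] at this

lemma Sy.empty (h : Sy V Ω) {x y : X} (hx : x ∉ V) (hy : y ∈ V ∨ x = y) :
    fl Ω (fun σ => σ x = y) = ∅ := by
  refine fl_eq_empty.2 fun σ hσ he => ?_
  rcases hy with hy | hy
  · apply hx
    have := h.pres σ hσ _ hy
    rwa [← he, (h.mt σ hσ).1 x] at this
  · exact (h.mt σ hσ).2 x (he.trans hy.symm)

/-- One-edge probability bound. -/
lemma Sy.P1 (h : Sy V Ω) {K : ℝ} (hK : K = Fintype.card X - 7) (hV : V.card ≤ 6)
    {x : X} (y : X) (hx : x ∉ V) :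
    K * ((fl Ω (fun σ => σ x = y)).card : ℝ) ≤ Ω.card := by
  by_cases hy : y ∈ V ∨ x = y
  · rw [h.empty hx hy]; simp
  · push Not at hy
    rw [h.count' hx hy.1 hy.2]
    have : (V.card : ℝ) ≤ 6 := by exact_mod_cast hV
    refine mul_le_mul_of_nonneg_right ?_ (Nat.cast_nonneg _)
    linarith

/-- Two-edge probability bound. -/
lemma Sy.P2 (h : Sy V Ω) {K : ℝ} (hK : K = Fintype.card X - 7) (hK0 : 0 < K) (hV : V.card ≤ 4)
    {x z : X} (y w : X) (hx : x ∉ V) (hz : z ∉ V) (hzx : z ≠ x) :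
    K ^ 2 * ((fl Ω (fun σ => z ≠ σ x ∧ σ x = y ∧ σ z = w)).card : ℝ) ≤ Ω.card := by
  by_cases hzy : z = y
  · have : fl Ω (fun σ => z ≠ σ x ∧ σ x = y ∧ σ z = w) = ∅ := by
      refine fl_eq_empty.2 fun σ _ he => ?_
      exact he.1 (hzy.trans he.2.1.symm)
    rw [this]; simp
  by_cases hy : y ∈ V ∨ x = y
  · have : fl Ω (fun σ => z ≠ σ x ∧ σ x = y ∧ σ z = w) = ∅ := by
      refine fl_eq_empty.2 fun σ hσ he => ?_
      have h0 := h.empty hx hy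
      exact (fl_eq_empty.1 h0) hσ he.2.1
    rw [this]; simp
  · push Not at hy
    have h1 := h.P1 hK (by omega) y hx
    have h2 := (h.filter (x := x) (y := y)).P1 hK (x := z)
      (by
        have := Finset.card_insert_le x (insert y V)
        have := Finset.card_insert_le y V
        omega) w
      (by simp [hzx, hzy, hz])
    rw [fl_fl] at h2
    have h3 : ((fl Ω (fun σ => z ≠ σ x ∧ σ x = y ∧ σ z = w)).card : ℝ) ≤
        (fl Ω (fun σ => σ x = y ∧ σ z = w)).card := by
      refine Nat.cast_le.2 (Finset.card_le_card fun σ hσ => ?_)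
      simp only [mem_fl] at hσ ⊢
      exact ⟨hσ.1, hσ.2.2⟩
    nlinarith

end Switching

section BadEdges

variable {X ι : Type*} [Fintype X] [DecidableEq X] [Fintype ι]
variable (π : X → ι) (H : SimpleGraph ι)

/-- The half-edge `x` belongs to some forbidden pattern of `σ`. -/
def bad (σ : X → X) (x : X) : Prop :=
  π x = π (σ x) ∨ H.Adj (π x) (π (σ x)) ∨
    ∃ z, z ≠ x ∧ z ≠ σ x ∧ π z = π x ∧ π (σ z) = π (σ x)

variable {π H}

lemma bad_symm {σ : X → X} (hσ : Mt σ) {x : X} (h : bad π H σ x) : bad π H σ (σ x) := by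
  unfold bad at *
  rw [hσ.1 x]
  rcases h with h | h | ⟨z, h1, h2, h3, h4⟩
  · exact Or.inl h.symm
  · exact Or.inr (Or.inl h.symm)
  · refine Or.inr (Or.inr ⟨σ z, fun he => h1 (hσ.1.injective he), fun he => h2 ?_, h4, ?_⟩)
    · rw [← he, hσ.1 z]
    · rw [hσ.1 z]; exact h3

lemma bad_symm_iff {σ : X → X} (hσ : Mt σ) {x : X} : bad π H σ (σ x) ↔ bad π H σ x :=
  ⟨fun h => by have := bad_symm hσ h; rwa [hσ.1 x] at this, bad_symm hσ⟩

/-- union bound -/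
lemma card_filter_exists_le {α β : Type*} (Ω : Finset α) (s : Finset β) (Q : β → α → Prop)
    (c : ℝ) (hc : ∀ b ∈ s, ((fl Ω (Q b)).card : ℝ) ≤ c) (R : α → Prop)
    (hR : ∀ a ∈ Ω, R a → ∃ b ∈ s, Q b a) :
    ((fl Ω R).card : ℝ) ≤ s.card * c := by
  have h1 : fl Ω R ⊆ s.biUnion (fun b => fl Ω (Q b)) := by
    intro a ha
    obtain ⟨h1, h2⟩ := mem_fl.1 ha
    obtain ⟨b, hb, hq⟩ := hR a h1 h2
    exact Finset.mem_biUnion.2 ⟨b, hb, mem_fl.2 ⟨h1, hq⟩⟩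
  have h2 : ((fl Ω R).card : ℝ) ≤ ∑ b ∈ s, ((fl Ω (Q b)).card : ℝ) := by
    exact_mod_cast (Finset.card_le_card h1).trans Finset.card_biUnion_le
  refine h2.trans ((Finset.sum_le_sum hc).trans ?_)
  rw [Finset.sum_const, nsmul_eq_mul]

lemma card_filter_or_le {α : Type*} (Ω : Finset α) (R P Q : α → Prop)
    (h : ∀ a ∈ Ω, R a → P a ∨ Q a) :
    ((fl Ω R).card : ℝ) ≤ (fl Ω P).card + (fl Ω Q).card := by
  have h1 : fl Ω R ⊆ fl Ω P ∪ fl Ω Q := by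
    intro a ha
    obtain ⟨h1, h2⟩ := mem_fl.1 ha
    rcases h a h1 h2 with h3 | h3
    · exact Finset.mem_union_left _ (mem_fl.2 ⟨h1, h3⟩)
    · exact Finset.mem_union_right _ (mem_fl.2 ⟨h1, h3⟩)
  exact_mod_cast (Finset.card_le_card h1).trans (Finset.card_union_le _ _)

/-- Degree bounds. -/
structure DB (π : X → ι) (H : SimpleGraph ι) (D S Q K : ℝ) : Prop where
  hD : ∀ u, ((fl Finset.univ (fun x => π x = u)).card : ℝ) ≤ D
  hS : ∀ u, ((fl Finset.univ (fun x => H.Adj u (π x))).card : ℝ) ≤ S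
  hQ : ((fl Finset.univ (fun x : X × X => π x.1 = π x.2)).card : ℝ) ≤ Q
  hK : K = Fintype.card X - 7
  hK0 : 0 < K
  hD0 : 0 ≤ D

/-- The probability bound for a half-edge to be bad. -/
noncomputable def epsA (D S Q K : ℝ) : ℝ := (5 * D + S) / K + D * Q / K ^ 2

variable {V : Finset X} {Ω : Finset (X → X)} {D S Q K : ℝ}

lemma Sy.boundA (h : Sy V Ω) (B : DB π H D S Q K) (hV : V.card ≤ 4) {x : X} (hx : x ∉ V) :
    ((fl Ω (fun σ => bad π H σ x)).card : ℝ) ≤ epsA D S Q K * Ω.card := by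
  have hK0 := B.hK0
  have hD0 := B.hD0
  have p1 : ∀ {x : X} (y : X), x ∉ V → ((fl Ω (fun σ => σ x = y)).card : ℝ) ≤ Ω.card / K := by
    intro x y hx
    rw [le_div_iff₀ hK0, mul_comm]
    exact h.P1 B.hK (by omega) y hx
  have e1 : ((fl Ω (fun σ => π x = π (σ x))).card : ℝ) ≤ D * (Ω.card / K) := by
    refine (card_filter_exists_le Ω (fl Finset.univ (fun y => π y = π x))
      (fun y σ => σ x = y) (Ω.card / K) (fun y _ => p1 y hx) _ ?_).trans ?_
    · intro σ _ he; exact ⟨σ x, mem_fl.2 ⟨Finset.mem_univ _, by simp [he]⟩, rfl⟩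
    · exact mul_le_mul_of_nonneg_right (B.hD _) (by positivity)
  have e2 : ((fl Ω (fun σ => H.Adj (π x) (π (σ x)))).card : ℝ) ≤ S * (Ω.card / K) := by
    refine (card_filter_exists_le Ω (fl Finset.univ (fun y => H.Adj (π x) (π y)))
      (fun y σ => σ x = y) (Ω.card / K) (fun y _ => p1 y hx) _ ?_).trans ?_
    · intro σ _ he; exact ⟨σ x, mem_fl.2 ⟨Finset.mem_univ _, by simp [he]⟩, rfl⟩
    · exact mul_le_mul_of_nonneg_right (B.hS _) (by positivity)
  have e3 : ((fl Ω (fun σ => ∃ w ∈ V, π (σ x) = π w)).card : ℝ) ≤ 4 * (D * (Ω.card / K)) := by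
    refine (card_filter_exists_le Ω V
      (fun w σ => π (σ x) = π w) (D * (Ω.card / K)) (fun w _ => ?_) _ ?_).trans ?_
    · refine (card_filter_exists_le Ω (fl Finset.univ (fun y => π y = π w))
        (fun y σ => σ x = y) (Ω.card / K) (fun y _ => p1 y hx) _ ?_).trans ?_
      · intro σ _ he; exact ⟨σ x, mem_fl.2 ⟨Finset.mem_univ _, by simp [he]⟩, rfl⟩
      · exact mul_le_mul_of_nonneg_right (B.hD _) (by positivity)
    · intro σ _ he; exact he
    · exact mul_le_mul_of_nonneg_right (by exact_mod_cast hV) (by positivity)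
  have e4 : ((fl Ω (fun σ => ∃ z, z ∉ V ∧ z ≠ x ∧ z ≠ σ x ∧ π z = π x ∧
      π (σ z) = π (σ x))).card : ℝ) ≤ D * (Q * (Ω.card / K ^ 2)) := by
    refine (card_filter_exists_le Ω (fl Finset.univ (fun z => π z = π x))
      (fun z σ => z ∉ V ∧ z ≠ x ∧ z ≠ σ x ∧ π (σ z) = π (σ x)) (Q * (Ω.card / K ^ 2))
      (fun z _ => ?_) _ ?_).trans ?_
    · have hQ0 : 0 ≤ Q := le_trans (Nat.cast_nonneg _) B.hQ
      by_cases hz : z ∉ V ∧ z ≠ x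
      · refine (card_filter_exists_le Ω (fl Finset.univ (fun y : X × X => π y.1 = π y.2))
          (fun y σ => z ≠ σ x ∧ σ x = y.1 ∧ σ z = y.2) (Ω.card / K ^ 2) (fun y _ => ?_) _ ?_).trans ?_
        · rw [le_div_iff₀ (by positivity), mul_comm]
          exact h.P2 B.hK B.hK0 hV y.1 y.2 hx hz.1 hz.2
        · intro σ _ he; exact ⟨(σ x, σ z), mem_fl.2 ⟨Finset.mem_univ _, by simp [he.2.2.2]⟩, he.2.2.1, rfl, rfl⟩
        · exact mul_le_mul_of_nonneg_right B.hQ (by positivity)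
      · rw [fl_eq_empty.2 fun σ _ he => hz ⟨he.1, he.2.1⟩]
        simp; positivity
    · rintro σ _ ⟨z, h1, h2, h3, h4, h5⟩; exact ⟨z, mem_fl.2 ⟨Finset.mem_univ _, h4⟩, h1, h2, h3, h5⟩
    · have hQ0 : 0 ≤ Q := le_trans (Nat.cast_nonneg _) B.hQ
      exact mul_le_mul_of_nonneg_right (B.hD _) (by positivity)
  have f1 := card_filter_or_le Ω (fun σ => bad π H σ x) (fun σ => π x = π (σ x))
    (fun σ => H.Adj (π x) (π (σ x)) ∨
    ∃ z, z ≠ x ∧ z ≠ σ x ∧ π z = π x ∧ π (σ z) = π (σ x)) (fun _ _ h => h)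
  have f2 := card_filter_or_le Ω (fun σ => H.Adj (π x) (π (σ x)) ∨
    ∃ z, z ≠ x ∧ z ≠ σ x ∧ π z = π x ∧ π (σ z) = π (σ x)) (fun σ => H.Adj (π x) (π (σ x)))
    (fun σ => ∃ z, z ≠ x ∧ z ≠ σ x ∧ π z = π x ∧ π (σ z) = π (σ x)) (fun _ _ h => h)
  have f3 := card_filter_or_le Ω (fun σ => ∃ z, z ≠ x ∧ z ≠ σ x ∧ π z = π x ∧ π (σ z) = π (σ x))
    (fun σ => ∃ w ∈ V, π (σ x) = π w)
    (fun σ => ∃ z, z ∉ V ∧ z ≠ x ∧ z ≠ σ x ∧ π z = π x ∧ π (σ z) = π (σ x)) (by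
      rintro σ hσ ⟨z, hz⟩
      by_cases hzV : z ∈ V
      · exact Or.inl ⟨σ z, h.pres σ hσ z hzV, hz.2.2.2.symm⟩
      · exact Or.inr ⟨z, hzV, hz⟩)
  have : epsA D S Q K * Ω.card = D * (Ω.card / K) + (S * (Ω.card / K) + (4 * (D * (Ω.card / K)) +
    D * (Q * (Ω.card / K ^ 2)))) := by unfold epsA; ring
  rw [this]
  refine f1.trans (add_le_add e1 (f2.trans (add_le_add e2 (f3.trans (add_le_add e3 e4)))))

lemma Sy.boundB (h : Sy V Ω) (B : DB π H D S Q K) (hV : V.card ≤ 4) (u v : ι) :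
    ((fl Ω (fun σ => ∃ z, z ∉ V ∧ π z = u ∧ π (σ z) = v)).card : ℝ) ≤
      D ^ 2 / K * Ω.card := by
  have hK0 := B.hK0
  have hD0 := B.hD0
  have p1 : ∀ {x : X} (y : X), x ∉ V → ((fl Ω (fun σ => σ x = y)).card : ℝ) ≤ Ω.card / K := by
    intro x y hx
    rw [le_div_iff₀ hK0, mul_comm]
    exact h.P1 B.hK (by omega) y hx
  have : D ^ 2 / K * Ω.card = D * (D * (Ω.card / K)) := by ring
  rw [this]
  refine (card_filter_exists_le Ω (fl Finset.univ (fun z => π z = u))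
      (fun z σ => z ∉ V ∧ π (σ z) = v) (D * (Ω.card / K)) (fun z _ => ?_) _ ?_).trans ?_
  · by_cases hz : z ∉ V
    · refine (card_filter_exists_le Ω (fl Finset.univ (fun y => π y = v))
        (fun y σ => σ z = y) (Ω.card / K) (fun y _ => p1 y hz) _ ?_).trans ?_
      · intro σ _ he; exact ⟨σ z, mem_fl.2 ⟨Finset.mem_univ _, he.2⟩, rfl⟩
      · exact mul_le_mul_of_nonneg_right (B.hD _) (by positivity)
    · rw [fl_eq_empty.2 fun σ _ he => hz he.1]
      simp; positivity
  · rintro σ _ ⟨z, h1, h2, h3⟩; exact ⟨z, mem_fl.2 ⟨Finset.mem_univ _, h2⟩, h1, h3⟩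
  · exact mul_le_mul_of_nonneg_right (B.hD _) (by positivity)

lemma epsA_nonneg (B : DB π H D S Q K) [Nonempty ι] : 0 ≤ epsA D S Q K := by
  have hQ0 : 0 ≤ Q := le_trans (Nat.cast_nonneg _) B.hQ
  have hS0 : 0 ≤ S := le_trans (Nat.cast_nonneg _) (B.hS (Classical.arbitrary ι))
  have hK0 := B.hK0
  have hD0 := B.hD0
  unfold epsA; positivity

/-- total error of one switching -/
noncomputable def epsT (m D S Q K : ℝ) : ℝ :=
  2 * epsA D S Q K + (1 + m * epsA D S Q K) / K + D ^ 2 / K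

/-- The good event for a switching. `R` is an extra bad event for the resulting matching. -/
def good (π : X → ι) (H : SimpleGraph ι) (x y : X) (R : (X → X) → Prop) (σ : X → X) : Prop :=
  ¬ bad π H σ x ∧ ¬ bad π H σ y ∧ σ x ≠ y ∧ ¬ bad π H (cj (σ x) y σ) (σ x) ∧ ¬ R (cj (σ x) y σ)

lemma Sy.step (h : Sy V Ω) (B : DB π H D S Q K) [Nonempty ι] (hV : V.card ≤ 2) {x y : X}
    (hx : x ∉ V) (hy : y ∉ V) (hxy : x ≠ y) (R : (X → X) → Prop)
    (hR : ((fl (fl Ω (fun σ => σ x = y)) R).card : ℝ) ≤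
      D ^ 2 / K * (fl Ω (fun σ => σ x = y)).card) :
    ((fl Ω (fun σ => ¬ good π H x y R σ)).card : ℝ) ≤
      epsT (Fintype.card X) D S Q K * Ω.card := by
  have hK0 := B.hK0
  have hcV : (V.card : ℝ) ≤ 2 := by exact_mod_cast hV
  have hKK : K ≤ (Fintype.card X : ℝ) - V.card - 1 := by rw [B.hK]; linarith
  have he0 := epsA_nonneg B
  have b1 := h.boundA B (by omega) hx
  have b2 := h.boundA B (by omega) hy
  have b3 : ((fl Ω (fun σ => R (cj (σ x) y σ))).card : ℝ) ≤ D ^ 2 / K * Ω.card := by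
    rw [h.count hx hy hxy R, h.count' hx hy hxy]
    have := mul_le_mul_of_nonneg_left hR (hK0.le.trans hKK)
    linarith
  have hc' := h.count' hx hy hxy
  have b4 : ((fl Ω (fun σ => σ x = y ∨ bad π H (cj (σ x) y σ) (σ x))).card : ℝ) ≤
      (1 + Fintype.card X * epsA D S Q K) / K * Ω.card := by
    have h1 := h.sum hx hy hxy (fun τ z => if z = y ∨ bad π H τ z then 1 else 0)
    rw [sum_fl] at h1
    rw [h1]
    have hsy := h.filter (x := x) (y := y)
    set Ω' := fl Ω (fun σ => σ x = y) with hΩ'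
    set V' := insert x (insert y V) with hV'
    have hV'c : V'.card ≤ 4 := by
        have h5 := Finset.card_insert_le x (insert y V)
        have h6 := Finset.card_insert_le y V
        rw [← hV'] at h5
        omega
    have h2 : ∑ τ ∈ Ω', ∑ z ∈ Finset.univ \ insert x V,
        (if z = y ∨ bad π H τ z then (1:ℝ) else 0) ≤
        (1 + Fintype.card X * epsA D S Q K) * Ω'.card := by
      rw [Finset.sum_comm]
      have : ∀ z ∈ Finset.univ \ insert x V, ∑ τ ∈ Ω',
          (if z = y ∨ bad π H τ z then (1:ℝ) else 0) ≤
          (if z = y then (Ω'.card : ℝ) else 0) + epsA D S Q K * Ω'.card := by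
        intro z hz
        simp only [Finset.mem_sdiff, Finset.mem_univ, true_and, Finset.mem_insert, not_or] at hz
        by_cases hzy : z = y
        · simp only [hzy, true_or, if_true, Finset.sum_const, nsmul_eq_mul, mul_one]
          have : 0 ≤ epsA D S Q K * Ω'.card := by positivity
          linarith
        · simp only [hzy, false_or, if_false, zero_add]
          rw [sum_fl]
          exact hsy.boundA B hV'c (by simp [hV', hz.1, hz.2, hzy])
      refine (Finset.sum_le_sum this).trans ?_
      rw [Finset.sum_add_distrib, Finset.sum_const, nsmul_eq_mul, add_mul, one_mul]
      refine add_le_add ?_ ?_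
      · rw [Finset.sum_ite_eq']
        split_ifs <;> simp
      · rw [mul_assoc]
        refine mul_le_mul_of_nonneg_right ?_ (by positivity)
        exact_mod_cast Finset.card_le_univ _
    refine h2.trans ?_
    rw [div_mul_eq_mul_div, le_div_iff₀ hK0, mul_assoc]
    refine mul_le_mul_of_nonneg_left ?_ (by positivity)
    rw [hc', mul_comm]
    exact mul_le_mul_of_nonneg_right hKK (by positivity)
  have f1 := card_filter_or_le Ω (fun σ => ¬ good π H x y R σ) (fun σ => bad π H σ x)
    (fun σ => bad π H σ y ∨ (σ x = y ∨ bad π H (cj (σ x) y σ) (σ x)) ∨ R (cj (σ x) y σ))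
    (by intro σ _ hg; unfold good at hg; tauto)
  have f2 := card_filter_or_le Ω
    (fun σ => bad π H σ y ∨ (σ x = y ∨ bad π H (cj (σ x) y σ) (σ x)) ∨ R (cj (σ x) y σ))
    _ _ (fun _ _ h => h)
  have f3 := card_filter_or_le Ω
    (fun σ => (σ x = y ∨ bad π H (cj (σ x) y σ) (σ x)) ∨ R (cj (σ x) y σ))
    _ _ (fun _ _ h => h)
  have : epsT (Fintype.card X) D S Q K * Ω.card = epsA D S Q K * Ω.card +
    (epsA D S Q K * Ω.card + ((1 + Fintype.card X * epsA D S Q K) / K * Ω.card +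
      D ^ 2 / K * Ω.card)) := by unfold epsT; ring
  rw [this]
  exact f1.trans (add_le_add b1 (f2.trans (add_le_add b2 (f3.trans (add_le_add b4 b3)))))

/-- Comparison of counts under a switching. -/
lemma Sy.compare (h : Sy V Ω) (B : DB π H D S Q K) [Nonempty ι] (hV : V.card ≤ 2) {x y : X}
    (hx : x ∉ V) (hy : y ∉ V) (hxy : x ≠ y) (R : (X → X) → Prop)
    (hR : ((fl (fl Ω (fun σ => σ x = y)) R).card : ℝ) ≤
      D ^ 2 / K * (fl Ω (fun σ => σ x = y)).card)
    (P P' : (X → X) → Prop)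
    (hP : ∀ σ ∈ Ω, good π H x y R σ → (P (cj (σ x) y σ) ↔ P' σ)) :
    |((Fintype.card X : ℝ) - V.card - 1) *
        ((fl (fl Ω (fun σ => σ x = y)) P).card : ℝ) - (fl Ω P').card| ≤
      epsT (Fintype.card X) D S Q K * Ω.card := by
  rw [← h.count hx hy hxy P]
  refine le_trans ?_ (h.step B hV hx hy hxy R hR)
  have h1 := card_filter_or_le Ω (fun σ => P (cj (σ x) y σ)) P' (fun σ => ¬ good π H x y R σ)
    (by intro σ hσ hp
        by_cases hg : good π H x y R σ
        · exact Or.inl ((hP σ hσ hg).1 hp)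
        · exact Or.inr hg)
  have h2 := card_filter_or_le Ω P' (fun σ => P (cj (σ x) y σ)) (fun σ => ¬ good π H x y R σ)
    (by intro σ hσ hp
        by_cases hg : good π H x y R σ
        · exact Or.inl ((hP σ hσ hg).2 hp)
        · exact Or.inr hg)
  rw [abs_le]; constructor <;> linarith

end BadEdges

section Counts

variable {n : ℕ} {d : Fin n → ℕ} {H : SimpleGraph (Fin n)}

/-- loops -/
noncomputable def fL (d : Fin n → ℕ) : Finset (HE d × HE d) :=
  fl Finset.univ (fun x => x.1.1 = x.2.1 ∧ (x.1.2 : ℕ) < (x.2.2 : ℕ))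

/-- edges of `H` -/
noncomputable def fN (H : SimpleGraph (Fin n)) (d : Fin n → ℕ) : Finset (HE d × HE d) :=
  fl Finset.univ (fun x => x.1.1 < x.2.1 ∧ H.Adj x.1.1 x.2.1)

/-- double edges -/
noncomputable def fM (H : SimpleGraph (Fin n)) (d : Fin n → ℕ) :
    Finset ((HE d × HE d) × (HE d × HE d)) :=
  fl Finset.univ (fun x => x.1.1.1 = x.2.1.1 ∧ x.1.2.1 = x.2.2.1 ∧ x.1.1.1 < x.1.2.1 ∧
    ¬ H.Adj x.1.1.1 x.1.2.1 ∧
    (x.1.1.2 : ℕ) < (x.2.1.2 : ℕ) ∧ (x.1.2.2 : ℕ) ≠ (x.2.2.2 : ℕ))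

lemma card_fl_univ {α : Type*} [Fintype α] (P : α → Prop) :
    Nat.card {x // P x} = (fl Finset.univ P).card := by
  rw [Nat.card_eq_fintype_card, Fintype.card_subtype]; simp only [fl]

lemma Lcount_eq (σ : HE d → HE d) : Lcount σ = (fl (fL d) (fun x => σ x.1 = x.2)).card := by
  unfold Lcount fL
  rw [card_fl_univ, fl_fl]; simp only [and_assoc]

lemma Ncount_eq (σ : HE d → HE d) :
    Ncount H σ = (fl (fN H d) (fun x => σ x.1 = x.2)).card := by
  unfold Ncount fN
  rw [card_fl_univ, fl_fl]; simp only [and_assoc]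

lemma Mcount_eq (σ : HE d → HE d) :
    Mcount H σ = (fl (fM H d) (fun x => σ x.1.1 = x.1.2 ∧ σ x.2.1 = x.2.2)).card := by
  unfold Mcount fM
  rw [card_fl_univ, fl_fl]; simp only [and_assoc]

/-- abbreviation for bad half-edges of the configuration model -/
abbrev bd (H : SimpleGraph (Fin n)) (σ : HE d → HE d) (x : HE d) : Prop :=
  bad (Sigma.fst : HE d → Fin n) H σ x

lemma bd_L {σ : HE d → HE d} {p : HE d × HE d} (hp : p ∈ fL d) (h : σ p.1 = p.2) :
    bd H σ p.1 := by
  left; rw [h]; exact (mem_fl.1 hp).2.1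

lemma bd_N {σ : HE d → HE d} {p : HE d × HE d} (hp : p ∈ fN H d) (h : σ p.1 = p.2) :
    bd H σ p.1 := by
  right; left; rw [h]; exact (mem_fl.1 hp).2.2

lemma bd_M1 {σ : HE d → HE d} {p : (HE d × HE d) × (HE d × HE d)} (hp : p ∈ fM H d)
    (h1 : σ p.1.1 = p.1.2) (h2 : σ p.2.1 = p.2.2) : bd H σ p.1.1 := by
  obtain ⟨-, a1, a2, a3, a4, a5, a6⟩ := mem_fl.1 hp
  right; right
  refine ⟨p.2.1, ?_, ?_, a1.symm, ?_⟩
  · intro he; rw [he] at a5; exact lt_irrefl _ a5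
  · intro he; rw [h1] at he; rw [← he, a1] at a3; exact lt_irrefl _ a3
  · rw [h1, h2]; exact a2.symm

lemma bd_M2 {σ : HE d → HE d} {p : (HE d × HE d) × (HE d × HE d)} (hp : p ∈ fM H d)
    (h1 : σ p.1.1 = p.1.2) (h2 : σ p.2.1 = p.2.2) : bd H σ p.2.1 := by
  obtain ⟨-, a1, a2, a3, a4, a5, a6⟩ := mem_fl.1 hp
  right; right
  refine ⟨p.1.1, ?_, ?_, a1, ?_⟩
  · intro he; rw [he] at a5; exact lt_irrefl _ a5
  · intro he; rw [h2] at he; rw [he, a2] at a3; exact lt_irrefl _ a3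
  · rw [h1, h2]; exact a2

variable {σ τ : HE d → HE d} {D : HE d → Prop}

lemma incl_L (ag : ∀ h, ¬ D h → σ h = τ h) (nb : ∀ h, D h → ¬ bd H σ h) :
    fl (fL d) (fun x => σ x.1 = x.2) ⊆ fl (fL d) (fun x => τ x.1 = x.2) := by
  intro p hp
  obtain ⟨h1, h2⟩ := mem_fl.1 hp
  refine mem_fl.2 ⟨h1, ?_⟩
  rw [← ag _ fun hD => nb _ hD (bd_L h1 h2)]; exact h2

lemma incl_N (ag : ∀ h, ¬ D h → σ h = τ h) (nb : ∀ h, D h → ¬ bd H σ h) :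
    fl (fN H d) (fun x => σ x.1 = x.2) ⊆ fl (fN H d) (fun x => τ x.1 = x.2) := by
  intro p hp
  obtain ⟨h1, h2⟩ := mem_fl.1 hp
  refine mem_fl.2 ⟨h1, ?_⟩
  rw [← ag _ fun hD => nb _ hD (bd_N h1 h2)]; exact h2

lemma incl_M (ag : ∀ h, ¬ D h → σ h = τ h) (nb : ∀ h, D h → ¬ bd H σ h) :
    fl (fM H d) (fun x => σ x.1.1 = x.1.2 ∧ σ x.2.1 = x.2.2) ⊆
      fl (fM H d) (fun x => τ x.1.1 = x.1.2 ∧ τ x.2.1 = x.2.2) := by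
  intro p hp
  obtain ⟨h1, h2, h3⟩ := mem_fl.1 hp
  refine mem_fl.2 ⟨h1, ?_, ?_⟩
  · rw [← ag _ fun hD => nb _ hD (bd_M1 h1 h2 h3)]; exact h2
  · rw [← ag _ fun hD => nb _ hD (bd_M2 h1 h2 h3)]; exact h3

lemma counts_0 (ag : ∀ h, ¬ D h → σ h = τ h) (nb : ∀ h, D h → ¬ bd H σ h)
    (nt : ∀ h, D h → ¬ bd H τ h) :
    Lcount τ = Lcount σ ∧ Mcount H τ = Mcount H σ ∧ Ncount H τ = Ncount H σ := by
  have ag' : ∀ h, ¬ D h → τ h = σ h := fun h hd => (ag h hd).symm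
  rw [Lcount_eq, Lcount_eq, Mcount_eq, Mcount_eq, Ncount_eq, Ncount_eq]
  exact ⟨congrArg _ ((incl_L ag' nt).antisymm (incl_L ag nb)),
    congrArg _ ((incl_M ag' nt).antisymm (incl_M ag nb)),
    congrArg _ ((incl_N ag' nt).antisymm (incl_N ag nb))⟩

/-- The new pairs of `τ` at `{x, y}`, single edge version: `L`-part -/
lemma sub_L {x y : HE d} (mt : Mt τ) (ag : ∀ h, ¬ D h → σ h = τ h)
    (nt : ∀ h, D h → bd H τ h → h = x ∨ h = y) (hxy : τ x = y)
    {p : HE d × HE d} (hp : p ∈ fl (fL d) (fun x => τ x.1 = x.2)) :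
    p ∈ fl (fL d) (fun x => σ x.1 = x.2) ∨ p = (x, y) ∨ p = (y, x) := by
  obtain ⟨h1, h2⟩ := mem_fl.1 hp
  by_cases hD : D p.1
  · right
    have hyx : τ y = x := by rw [← hxy]; exact mt.1 x
    rcases nt _ hD (bd_L h1 h2) with h | h
    · left; ext1
      · exact h
      · rw [← h2, h, hxy]
    · right; ext1
      · exact h
      · rw [← h2, h, hyx]
  · left; exact mem_fl.2 ⟨h1, by rw [ag _ hD]; exact h2⟩

lemma sub_N {x y : HE d} (mt : Mt τ) (ag : ∀ h, ¬ D h → σ h = τ h)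
    (nt : ∀ h, D h → bd H τ h → h = x ∨ h = y) (hxy : τ x = y)
    {p : HE d × HE d} (hp : p ∈ fl (fN H d) (fun x => τ x.1 = x.2)) :
    p ∈ fl (fN H d) (fun x => σ x.1 = x.2) ∨ p = (x, y) ∨ p = (y, x) := by
  obtain ⟨h1, h2⟩ := mem_fl.1 hp
  by_cases hD : D p.1
  · right
    have hyx : τ y = x := by rw [← hxy]; exact mt.1 x
    rcases nt _ hD (bd_N h1 h2) with h | h
    · left; ext1
      · exact h
      · rw [← h2, h, hxy]
    · right; ext1
      · exact h
      · rw [← h2, h, hyx]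
  · left; exact mem_fl.2 ⟨h1, by rw [ag _ hD]; exact h2⟩

lemma sub_M {x y : HE d} (mt : Mt τ) (ag : ∀ h, ¬ D h → σ h = τ h)
    (nt : ∀ h, D h → bd H τ h → h = x ∨ h = y) (hxy : τ x = y)
    {p : (HE d × HE d) × (HE d × HE d)}
    (hp : p ∈ fl (fM H d) (fun x => τ x.1.1 = x.1.2 ∧ τ x.2.1 = x.2.2)) :
    p ∈ fl (fM H d) (fun x => σ x.1.1 = x.1.2 ∧ σ x.2.1 = x.2.2) ∨
      p.1 = (x, y) ∨ p.1 = (y, x) ∨ p.2 = (x, y) ∨ p.2 = (y, x) := by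
  obtain ⟨h1, h2, h3⟩ := mem_fl.1 hp
  have hyx : τ y = x := by rw [← hxy]; exact mt.1 x
  by_cases hD1 : D p.1.1
  · right
    rcases nt _ hD1 (bd_M1 h1 h2 h3) with h | h
    · left; ext1
      · exact h
      · rw [← h2, h, hxy]
    · right; left; ext1
      · exact h
      · rw [← h2, h, hyx]
  by_cases hD2 : D p.2.1
  · right
    rcases nt _ hD2 (bd_M2 h1 h2 h3) with h | h
    · right; right; left; ext1
      · exact h
      · rw [← h3, h, hxy]
    · right; right; right; ext1
      · exact h
      · rw [← h3, h, hyx]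
  · left; exact mem_fl.2 ⟨h1, by rw [ag _ hD1]; exact h2, by rw [ag _ hD2]; exact h3⟩

lemma counts_L {x y : HE d} (hA : (x, y) ∈ fL d) (mt : Mt τ) (ag : ∀ h, ¬ D h → σ h = τ h)
    (nb : ∀ h, D h → ¬ bd H σ h) (hDx : D x)
    (nt : ∀ h, D h → bd H τ h → h = x ∨ h = y) (hxy : τ x = y) :
    Lcount τ = Lcount σ + 1 ∧ Mcount H τ = Mcount H σ ∧ Ncount H τ = Ncount H σ := by
  rw [Lcount_eq, Lcount_eq, Mcount_eq, Mcount_eq, Ncount_eq, Ncount_eq]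
  obtain ⟨-, a1, a2⟩ := mem_fl.1 hA
  dsimp only at a1 a2
  refine ⟨?_, congrArg _ (Finset.Subset.antisymm (fun p hp => ?_) (incl_M ag nb)),
    congrArg _ (Finset.Subset.antisymm (fun p hp => ?_) (incl_N ag nb))⟩
  · have hne : (x, y) ∉ fl (fL d) (fun x => σ x.1 = x.2) := by
      intro hm
      obtain ⟨h1, h2⟩ := mem_fl.1 hm
      exact nb x hDx (bd_L h1 h2)
    rw [← Finset.card_insert_of_notMem hne]
    refine congrArg _ (Finset.Subset.antisymm (fun p hp => ?_) ?_)
    · rcases sub_L mt ag nt hxy hp with h | h | h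
      · exact Finset.mem_insert_of_mem h
      · rw [h]; exact Finset.mem_insert_self _ _
      · obtain ⟨-, b1, b2⟩ := mem_fl.1 (mem_fl.1 hp).1
        rw [h] at b2; dsimp only at b2; omega
    · refine Finset.insert_subset (mem_fl.2 ⟨hA, hxy⟩) (incl_L ag nb)
  · have b := (mem_fl.1 (mem_fl.1 hp).1).2
    obtain ⟨b1, b2, b3, -⟩ := b
    have b3' := b3
    rw [b1, b2] at b3'
    rcases sub_M mt ag nt hxy hp with h | h | h | h | h
    · exact h
    · rw [h] at b3; exact absurd b3 (by simp [a1])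
    · rw [h] at b3; exact absurd b3 (by simp [a1])
    · rw [h] at b3'; exact absurd b3' (by simp [a1])
    · rw [h] at b3'; exact absurd b3' (by simp [a1])
  · have b := (mem_fl.1 (mem_fl.1 hp).1).2
    rcases sub_N mt ag nt hxy hp with h | h | h
    · exact h
    · rw [h] at b; exact absurd b.1 (by simp [a1])
    · rw [h] at b; exact absurd b.1 (by simp [a1])

lemma counts_N {x y : HE d} (hA : (x, y) ∈ fN H d) (mt : Mt τ) (ag : ∀ h, ¬ D h → σ h = τ h)
    (nb : ∀ h, D h → ¬ bd H σ h) (hDx : D x)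
    (nt : ∀ h, D h → bd H τ h → h = x ∨ h = y) (hxy : τ x = y) :
    Lcount τ = Lcount σ ∧ Mcount H τ = Mcount H σ ∧ Ncount H τ = Ncount H σ + 1 := by
  rw [Lcount_eq, Lcount_eq, Mcount_eq, Mcount_eq, Ncount_eq, Ncount_eq]
  obtain ⟨-, a1, a2⟩ := mem_fl.1 hA
  dsimp only at a1 a2
  refine ⟨congrArg _ (Finset.Subset.antisymm (fun p hp => ?_) (incl_L ag nb)),
    congrArg _ (Finset.Subset.antisymm (fun p hp => ?_) (incl_M ag nb)), ?_⟩
  · have b := (mem_fl.1 (mem_fl.1 hp).1).2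
    rcases sub_L mt ag nt hxy hp with h | h | h
    · exact h
    · rw [h] at b; exact absurd b.1 a1.ne
    · rw [h] at b; exact absurd b.1 a1.ne'
  · have b := (mem_fl.1 (mem_fl.1 hp).1).2
    obtain ⟨b1, b2, -, b3, -⟩ := b
    have b3' := b3
    rw [b1, b2] at b3'
    rcases sub_M mt ag nt hxy hp with h | h | h | h | h
    · exact h
    · rw [h] at b3; exact absurd a2 b3
    · rw [h] at b3; exact absurd a2.symm b3
    · rw [h] at b3'; exact absurd a2 b3'
    · rw [h] at b3'; exact absurd a2.symm b3'
  · have hne : (x, y) ∉ fl (fN H d) (fun x => σ x.1 = x.2) := by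
      intro hm
      obtain ⟨h1, h2⟩ := mem_fl.1 hm
      exact nb x hDx (bd_N h1 h2)
    rw [← Finset.card_insert_of_notMem hne]
    refine congrArg _ (Finset.Subset.antisymm (fun p hp => ?_) ?_)
    · rcases sub_N mt ag nt hxy hp with h | h | h
      · exact Finset.mem_insert_of_mem h
      · rw [h]; exact Finset.mem_insert_self _ _
      · obtain ⟨-, b1, b2⟩ := mem_fl.1 (mem_fl.1 hp).1
        rw [h] at b1; exact absurd b1 a1.asymm
    · refine Finset.insert_subset (mem_fl.2 ⟨hA, hxy⟩) (incl_N ag nb)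

lemma counts_M {x₁ y₁ x y : HE d} (hA : ((x₁, y₁), (x, y)) ∈ fM H d) (mt : Mt τ)
    (ag : ∀ h, ¬ D h → σ h = τ h)
    (nb : ∀ h, D h → ¬ bd H σ h) (hDx : D x)
    (nt : ∀ h, D h → bd H τ h → h = x ∨ h = y) (hxy : τ x = y) (hxy₁ : τ x₁ = y₁)
    (np : ∀ z : HE d, z.1 = x.1 → (τ z).1 = y.1 → z = x₁ ∨ z = x) :
    Lcount τ = Lcount σ ∧ Mcount H τ = Mcount H σ + 1 ∧ Ncount H τ = Ncount H σ := by
  rw [Lcount_eq, Lcount_eq, Mcount_eq, Mcount_eq, Ncount_eq, Ncount_eq]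
  obtain ⟨-, a1, a2, a3, a4, a5, a6⟩ := mem_fl.1 hA
  dsimp only at a1 a2 a3 a4 a5 a6
  refine ⟨congrArg _ (Finset.Subset.antisymm (fun p hp => ?_) (incl_L ag nb)), ?_,
    congrArg _ (Finset.Subset.antisymm (fun p hp => ?_) (incl_N ag nb))⟩
  · have b := (mem_fl.1 (mem_fl.1 hp).1).2
    rw [a1, a2] at a3
    rcases sub_L mt ag nt hxy hp with h | h | h
    · exact h
    · rw [h] at b; exact absurd b.1 a3.ne
    · rw [h] at b; exact absurd b.1 a3.ne'
  · have hne : ((x₁, y₁), (x, y)) ∉ fl (fM H d) (fun x => σ x.1.1 = x.1.2 ∧ σ x.2.1 = x.2.2) := by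
      intro hm
      obtain ⟨h1, h2, h3⟩ := mem_fl.1 hm
      exact nb x hDx (bd_M2 h1 h2 h3)
    rw [← Finset.card_insert_of_notMem hne]
    refine congrArg _ (Finset.Subset.antisymm (fun p hp => ?_) ?_)
    · have hp0 := hp
      obtain ⟨hp1, e1, e2⟩ := mem_fl.1 hp
      obtain ⟨-, b1, b2, b3, b4, b5, b6⟩ := mem_fl.1 hp1
      obtain ⟨⟨p1, q1⟩, ⟨p2, q2⟩⟩ := p
      dsimp only at b1 b2 b3 b4 b5 b6 e1 e2
      have a3' := a3
      rw [a1, a2] at a3'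
      have b3' := b3
      rw [b1, b2] at b3'
      rcases sub_M mt ag nt hxy hp0 with h | h | h | h | h
      · exact Finset.mem_insert_of_mem h
      · -- first edge of `p` is `(x, y)`
        simp only [Prod.mk.injEq] at h
        obtain ⟨rfl, rfl⟩ := h
        exfalso
        rcases np p2 b1.symm (by rw [e2]; exact b2.symm) with h | h
        · rw [h] at b5; omega
        · rw [h] at b5; omega
      · simp only [Prod.mk.injEq] at h
        obtain ⟨rfl, rfl⟩ := h
        exact absurd b3 a3'.asymm
      · simp only [Prod.mk.injEq] at h
        obtain ⟨rfl, rfl⟩ := h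
        rcases np p1 b1 (by rw [e1]; exact b2) with h | h
        · subst h
          have : q1 = y₁ := by rw [← e1, hxy₁]
          rw [this]; exact Finset.mem_insert_self _ _
        · rw [h] at b5; omega
      · simp only [Prod.mk.injEq] at h
        obtain ⟨rfl, rfl⟩ := h
        exact absurd b3' a3'.asymm
    · refine Finset.insert_subset (mem_fl.2 ⟨hA, hxy₁, hxy⟩) (incl_M ag nb)
  · have b := (mem_fl.1 (mem_fl.1 hp).1).2
    rw [a1, a2] at a4
    rcases sub_N mt ag nt hxy hp with h | h | h
    · exact h
    · rw [h] at b; exact absurd b.2 a4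
    · rw [h] at b; exact absurd b.2.symm a4

end Counts

section Stein

variable {n : ℕ} {d : Fin n → ℕ} {H : SimpleGraph (Fin n)}

lemma cj_agree {X : Type*} [DecidableEq X] {σ : X → X} (mt : Mt σ) {x y h : X}
    (hh : ¬ (h = x ∨ h = y ∨ h = σ x ∨ h = σ y)) : σ h = cj (σ x) y σ h := by
  push Not at hh
  obtain ⟨h1, h2, h3, h4⟩ := hh
  simp only [cj]
  rw [Equiv.swap_apply_of_ne_of_ne h3 h2, Equiv.swap_apply_of_ne_of_ne]
  · exact fun he => h1 (mt.1.injective he)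
  · intro he; apply h4; rw [← he, mt.1 h]

lemma cj_x {X : Type*} [DecidableEq X] {σ : X → X} (mt : Mt σ) {x y : X} (hxy : x ≠ y) :
    cj (σ x) y σ x = y := by
  simp only [cj]
  rw [Equiv.swap_apply_of_ne_of_ne (mt.2 x).symm hxy, Equiv.swap_apply_left]

lemma cj_sx {X : Type*} [DecidableEq X] {σ : X → X} (mt : Mt σ) {x y : X} (hxy : x ≠ y) :
    cj (σ x) y σ (σ x) = σ y := by
  simp only [cj]
  rw [Equiv.swap_apply_left, Equiv.swap_apply_of_ne_of_ne]
  · intro he; exact hxy (mt.1.injective he).symm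
  · exact mt.2 y

lemma good_nb {σ : HE d → HE d} {x y : HE d} {R : (HE d → HE d) → Prop} (mt : Mt σ)
    (hg : good (Sigma.fst : HE d → Fin n) H x y R σ) :
    ∀ h, (h = x ∨ h = y ∨ h = σ x ∨ h = σ y) → ¬ bd H σ h := by
  obtain ⟨h1, h2, -⟩ := hg
  rintro h (rfl | rfl | rfl | rfl)
  · exact h1
  · exact h2
  · exact fun hb => h1 ((bad_symm_iff mt).1 hb)
  · exact fun hb => h2 ((bad_symm_iff mt).1 hb)

lemma good_nt {σ : HE d → HE d} {x y : HE d} {R : (HE d → HE d) → Prop} (mt : Mt σ)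
    (hxy : x ≠ y) (hg : good (Sigma.fst : HE d → Fin n) H x y R σ) :
    ∀ h, (h = x ∨ h = y ∨ h = σ x ∨ h = σ y) → bd H (cj (σ x) y σ) h → h = x ∨ h = y := by
  obtain ⟨-, -, -, h4, -⟩ := hg
  rintro h (rfl | rfl | rfl | rfl) hb
  · exact Or.inl rfl
  · exact Or.inr rfl
  · exact absurd hb h4
  · rw [← cj_sx mt hxy] at hb
    exact absurd ((bad_symm_iff (cj_mt mt)).1 hb) h4

/-- all matchings -/
noncomputable def Om (d : Fin n → ℕ) : Finset (HE d → HE d) := fl Finset.univ Mt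

lemma sy_Om : Sy (∅ : Finset (HE d)) (Om d) :=
  ⟨fun _ h => (mem_fl.1 h).2, fun _ _ _ hv => absurd hv (Finset.notMem_empty _),
    fun _ _ _ _ _ hσ => mem_fl.2 ⟨Finset.mem_univ _, cj_mt (mem_fl.1 hσ).2⟩⟩

/-- the event that the counts equal `(a, b, c)` -/
def W (H : SimpleGraph (Fin n)) (a b c : ℕ) (σ : HE d → HE d) : Prop :=
  Lcount σ = a ∧ Mcount H σ = b ∧ Ncount H σ = c

variable {D S Q K : ℝ}

lemma stein_L_one (B : DB (Sigma.fst : HE d → Fin n) H D S Q K) [Nonempty (Fin n)]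
    (a b c : ℕ) {A : HE d × HE d} (hA : A ∈ fL d) :
    |((Fintype.card (HE d) : ℝ) - 1) *
      ((fl (fl (Om d) (fun σ => σ A.1 = A.2)) (W H (a + 1) b c)).card : ℝ) -
        (fl (Om d) (W H a b c)).card| ≤ epsT (Fintype.card (HE d)) D S Q K * (Om d).card := by
  obtain ⟨x, y⟩ := A
  have hK0 := B.hK0
  have hxy : x ≠ y := by
    rintro rfl; exact lt_irrefl _ (mem_fl.1 hA).2.2
  have := sy_Om.compare B (by simp) (Finset.notMem_empty x) (Finset.notMem_empty y) hxy
    (fun _ => False) (by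
      have : ∀ Ω : Finset (HE d → HE d), fl Ω (fun _ => False) = ∅ := fun Ω => by
        rw [fl_eq_empty]; exact fun _ _ => id
      rw [this]; simp; positivity) (W H (a + 1) b c) (W H a b c) (by
    intro σ hσ hg
    have mt := (sy_Om.mt σ hσ)
    obtain ⟨h1, h2, h3⟩ := counts_L hA (cj_mt mt) (fun h hh => cj_agree mt hh) (good_nb mt hg)
      (Or.inl rfl) (good_nt mt hxy hg) (cj_x mt hxy)
    unfold W
    rw [h1, h2, h3]; simp)
  simpa using this

lemma stein_N_one (B : DB (Sigma.fst : HE d → Fin n) H D S Q K) [Nonempty (Fin n)]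
    (a b c : ℕ) {A : HE d × HE d} (hA : A ∈ fN H d) :
    |((Fintype.card (HE d) : ℝ) - 1) *
      ((fl (fl (Om d) (fun σ => σ A.1 = A.2)) (W H a b (c + 1))).card : ℝ) -
        (fl (Om d) (W H a b c)).card| ≤ epsT (Fintype.card (HE d)) D S Q K * (Om d).card := by
  obtain ⟨x, y⟩ := A
  have hK0 := B.hK0
  have hxy : x ≠ y := by
    rintro rfl; exact lt_irrefl _ (mem_fl.1 hA).2.1
  have := sy_Om.compare B (by simp) (Finset.notMem_empty x) (Finset.notMem_empty y) hxy
    (fun _ => False) (by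
      have : ∀ Ω : Finset (HE d → HE d), fl Ω (fun _ => False) = ∅ := fun Ω => by
        rw [fl_eq_empty]; exact fun _ _ => id
      rw [this]; simp; positivity) (W H a b (c + 1)) (W H a b c) (by
    intro σ hσ hg
    have mt := (sy_Om.mt σ hσ)
    obtain ⟨h1, h2, h3⟩ := counts_N hA (cj_mt mt) (fun h hh => cj_agree mt hh) (good_nb mt hg)
      (Or.inl rfl) (good_nt mt hxy hg) (cj_x mt hxy)
    unfold W
    rw [h1, h2, h3]; simp)
  simpa using this

lemma fM_facts {x₁ y₁ x y : HE d} (hA : ((x₁, y₁), (x, y)) ∈ fM H d) :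
    x₁ ≠ y₁ ∧ x ≠ y ∧ x ≠ x₁ ∧ x ≠ y₁ ∧ y ≠ x₁ ∧ y ≠ y₁ := by
  obtain ⟨-, a1, a2, a3, a4, a5, a6⟩ := mem_fl.1 hA
  dsimp only at a1 a2 a3 a4 a5 a6
  refine ⟨?_, ?_, ?_, ?_, ?_, ?_⟩
  · rintro rfl; exact lt_irrefl _ a3
  · rintro rfl; rw [a1, a2] at a3; exact lt_irrefl _ a3
  · rintro rfl; exact lt_irrefl _ a5
  · rintro rfl; rw [a1] at a3; exact lt_irrefl _ a3
  · rintro rfl; rw [a2] at a3; exact lt_irrefl _ a3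
  · rintro rfl; exact a6 rfl

lemma card_V1 {x₁ y₁ : HE d} (h : x₁ ≠ y₁) :
    (insert x₁ (insert y₁ (∅ : Finset (HE d)))).card = 2 := by
  rw [Finset.card_insert_of_notMem (by simp [h])]; simp

lemma stein_M_one (B : DB (Sigma.fst : HE d → Fin n) H D S Q K) [Nonempty (Fin n)]
    (a b c : ℕ) {A : (HE d × HE d) × (HE d × HE d)} (hA : A ∈ fM H d) :
    |((Fintype.card (HE d) : ℝ) - 1) * ((Fintype.card (HE d) : ℝ) - 3) *
      ((fl (fl (Om d) (fun σ => σ A.1.1 = A.1.2 ∧ σ A.2.1 = A.2.2)) (W H a (b + 1) c)).card : ℝ) -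
        (fl (Om d) (W H a b c)).card| ≤
      2 * epsT (Fintype.card (HE d)) D S Q K * (Om d).card := by
  obtain ⟨⟨x₁, y₁⟩, ⟨x, y⟩⟩ := A
  have hK0 := B.hK0
  obtain ⟨n1, n2, n3, n4, n5, n6⟩ := fM_facts hA
  obtain ⟨-, a1, a2, a3, a4, a5, a6⟩ := mem_fl.1 hA
  dsimp only at a1 a2 a3 a4 a5 a6 ⊢
  have s1 : Sy (insert x₁ (insert y₁ (∅ : Finset (HE d)))) (fl (Om d) (fun σ => σ x₁ = y₁)) :=
    sy_Om.filter
  have s2 := s1.filter (x := x) (y := y)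
  have c1 := card_V1 n1
  have c2 : (insert x (insert y (insert x₁ (insert y₁ (∅ : Finset (HE d)))))).card ≤ 4 := by
    refine (Finset.card_insert_le _ _).trans ?_
    have := Finset.card_insert_le y (insert x₁ (insert y₁ (∅ : Finset (HE d))))
    omega
  have st1 := sy_Om.compare B (by simp) (Finset.notMem_empty x₁) (Finset.notMem_empty y₁) n1
    (fun τ => bd H τ x₁) (by
      refine le_trans ?_ (s1.boundB B (by omega) x₁.1 y₁.1)
      refine Nat.cast_le.2 (Finset.card_le_card fun τ hτ => ?_)
      obtain ⟨h1, h2⟩ := mem_fl.1 hτ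
      refine mem_fl.2 ⟨h1, ?_⟩
      have h3 := (mem_fl.1 h1).2
      unfold bd bad at h2
      rw [h3] at h2
      rcases h2 with h2 | h2 | ⟨z, b1, b2, b3, b4⟩
      · exact absurd h2 a3.ne
      · exact absurd h2 a4
      · exact ⟨z, by simp [b1, b2], b3, b4⟩) (W H a b c) (W H a b c) (by
    intro σ hσ hg
    have mt := (sy_Om.mt σ hσ)
    have nt : ∀ h, (h = x₁ ∨ h = y₁ ∨ h = σ x₁ ∨ h = σ y₁) → ¬ bd H (cj (σ x₁) y₁ σ) h := by
      intro h hh hb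
      have hx : ¬ bd H (cj (σ x₁) y₁ σ) x₁ := hg.2.2.2.2
      rcases good_nt mt n1 hg h hh hb with rfl | rfl
      · exact hx hb
      · rw [← cj_x mt n1] at hb
        simp only [cj_x mt n1] at hb
        apply hx
        have h5 : bd H (cj (σ x₁) h σ) (cj (σ x₁) h σ x₁) := by rw [cj_x mt n1]; exact hb
        exact (bad_symm_iff (cj_mt mt)).1 h5
    obtain ⟨h1, h2, h3⟩ := counts_0 (fun h hh => cj_agree mt hh) (good_nb mt hg) nt
    unfold W
    rw [h1, h2, h3])
  have st2 := s1.compare B (by omega) (x := x) (y := y) (by simp [n3, n4]) (by simp [n5, n6]) n2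
    (fun τ => ∃ z, z ∉ (insert x (insert y (insert x₁ (insert y₁ (∅ : Finset (HE d)))))) ∧
      z.1 = x.1 ∧ (τ z).1 = y.1) (s2.boundB B c2 x.1 y.1) (W H a (b + 1) c) (W H a b c) (by
    intro σ hσ hg
    have mt := (s1.mt σ hσ)
    have hσ1 := (mem_fl.1 hσ).2
    have hσy : σ y₁ = x₁ := by rw [← hσ1]; exact mt.1 x₁
    have e1 : cj (σ x) y σ x₁ = y₁ := by
      rw [← cj_agree mt, hσ1]
      rintro (h | h | h | h)
      · exact n3 h.symm
      · exact n5 h.symm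
      · rw [h, mt.1 x] at hσ1; exact n4 hσ1
      · rw [h, mt.1 y] at hσ1; exact n6 hσ1
    obtain ⟨h1, h2, h3⟩ := counts_M hA (cj_mt mt) (fun h hh => cj_agree mt hh) (good_nb mt hg)
      (Or.inl rfl) (good_nt mt n2 hg) (cj_x mt n2) e1 (by
        intro z hz1 hz2
        have hR := hg.2.2.2.2
        by_contra hz
        push Not at hz
        refine hR ⟨z, ?_, hz1, hz2⟩
        simp only [Finset.mem_insert, Finset.notMem_empty, or_false, not_or]
        rw [a1, a2] at a3
        refine ⟨hz.2, ?_, hz.1, ?_⟩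
        · rintro rfl; exact a3.ne' hz1
        · rintro rfl; exact a3.ne' (a2.symm.trans hz1))
    unfold W
    rw [h1, h2, h3]; simp)
  have hc := sy_Om.count' (Finset.notMem_empty x₁) (Finset.notMem_empty y₁) n1
  rw [c1] at st2
  simp only [Finset.card_empty, Nat.cast_zero, sub_zero] at hc st1
  rw [fl_fl (fun σ : HE d → HE d => σ x₁ = y₁)] at st2
  have hm : (0:ℝ) ≤ (Fintype.card (HE d) : ℝ) - 1 := by have := B.hK; linarith
  have st2' := mul_le_mul_of_nonneg_left st2 hm
  rw [← abs_of_nonneg hm, ← abs_mul, abs_of_nonneg hm] at st2'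
  push_cast at st2'
  have e : ((Fintype.card (HE d) : ℝ) - 1) * (epsT (Fintype.card (HE d)) D S Q K *
    (fl (Om d) (fun σ => σ x₁ = y₁)).card) = epsT (Fintype.card (HE d)) D S Q K * (Om d).card := by
    rw [hc]; ring
  rw [e] at st2'
  rw [abs_le] at st1 st2' ⊢
  constructor <;> nlinarith [st1.1, st1.2, st2'.1, st2'.2]

/-- Double counting. -/
lemma dcount {α β : Type*} (Ω : Finset α) (F : Finset β) (R : β → α → Prop) :
    ∑ A ∈ F, ((fl Ω (R A)).card : ℝ) = ∑ σ ∈ Ω, ((fl F (fun A => R A σ)).card : ℝ) := by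
  simp only [← sum_fl]
  rw [Finset.sum_comm]

lemma fl_comm {α : Type*} (P Q : α → Prop) (Ω : Finset α) : fl (fl Ω P) Q = fl (fl Ω Q) P := by
  ext a; simp only [mem_fl]; tauto

/-- Summing one-pattern estimates. -/
lemma stein_sum {α β : Type*} (Ω : Finset α) (F : Finset β) (R : β → α → Prop)
    (P P' : α → Prop) (k : ℕ) (hk : ∀ σ, P σ → (fl F (fun A => R A σ)).card = k)
    (m e w : ℝ) (_hw : w = (fl Ω P').card)
    (h : ∀ A ∈ F, |m * ((fl (fl Ω (R A)) P).card : ℝ) - w| ≤ e) :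
    |m * (k * ((fl Ω P).card : ℝ)) - F.card * w| ≤ F.card * e := by
  have h1 : ∑ A ∈ F, ((fl (fl Ω (R A)) P).card : ℝ) = k * (fl Ω P).card := by
    simp only [fun A => fl_comm (R A) P Ω]
    rw [dcount, Finset.sum_congr rfl (g := fun _ => (k : ℝ)), Finset.sum_const, nsmul_eq_mul,
      mul_comm]
    intro σ hσ
    rw [hk σ (mem_fl.1 hσ).2]
  have h2 : m * (k * ((fl Ω P).card : ℝ)) - F.card * w =
      ∑ A ∈ F, (m * ((fl (fl Ω (R A)) P).card : ℝ) - w) := by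
    rw [Finset.sum_sub_distrib, ← Finset.mul_sum, h1, Finset.sum_const, nsmul_eq_mul]
  rw [h2]
  refine (Finset.abs_sum_le_sum_abs _ _).trans ((Finset.sum_le_sum h).trans ?_)
  rw [Finset.sum_const, nsmul_eq_mul]

lemma stein_L (B : DB (Sigma.fst : HE d → Fin n) H D S Q K) [Nonempty (Fin n)] (a b c : ℕ) :
    |((Fintype.card (HE d) : ℝ) - 1) * ((a + 1 : ℕ) * ((fl (Om d) (W H (a + 1) b c)).card : ℝ)) -
        (fL d).card * ((fl (Om d) (W H a b c)).card : ℝ)| ≤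
      (fL d).card * (epsT (Fintype.card (HE d)) D S Q K * (Om d).card) :=
  stein_sum (Om d) (fL d) (fun A σ => σ A.1 = A.2) (W H (a + 1) b c) (W H a b c) (a + 1)
    (fun σ h => by rw [← Lcount_eq]; exact h.1) _ _ _ rfl (fun _ hA => stein_L_one B a b c hA)

lemma stein_N (B : DB (Sigma.fst : HE d → Fin n) H D S Q K) [Nonempty (Fin n)] (a b c : ℕ) :
    |((Fintype.card (HE d) : ℝ) - 1) * ((c + 1 : ℕ) * ((fl (Om d) (W H a b (c + 1))).card : ℝ)) -
        (fN H d).card * ((fl (Om d) (W H a b c)).card : ℝ)| ≤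
      (fN H d).card * (epsT (Fintype.card (HE d)) D S Q K * (Om d).card) :=
  stein_sum (Om d) (fN H d) (fun A σ => σ A.1 = A.2) (W H a b (c + 1)) (W H a b c) (c + 1)
    (fun σ h => by rw [← Ncount_eq]; exact h.2.2) _ _ _ rfl (fun _ hA => stein_N_one B a b c hA)

lemma stein_M (B : DB (Sigma.fst : HE d → Fin n) H D S Q K) [Nonempty (Fin n)] (a b c : ℕ) :
    |((Fintype.card (HE d) : ℝ) - 1) * ((Fintype.card (HE d) : ℝ) - 3) *
        ((b + 1 : ℕ) * ((fl (Om d) (W H a (b + 1) c)).card : ℝ)) -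
        (fM H d).card * ((fl (Om d) (W H a b c)).card : ℝ)| ≤
      (fM H d).card * (2 * epsT (Fintype.card (HE d)) D S Q K * (Om d).card) :=
  stein_sum (Om d) (fM H d) (fun A σ => σ A.1.1 = A.1.2 ∧ σ A.2.1 = A.2.2)
    (W H a (b + 1) c) (W H a b c) (b + 1)
    (fun σ h => by rw [← Mcount_eq]; exact h.2.1) _ _ _ rfl (fun _ hA => stein_M_one B a b c hA)

lemma mean_L : ((Fintype.card (HE d) : ℝ) - 1) * ∑ σ ∈ Om d, (Lcount σ : ℝ) =
    (fL d).card * (Om d).card := by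
  simp only [Lcount_eq]
  rw [← dcount (Om d) (fL d) (fun A σ => σ A.1 = A.2), Finset.mul_sum,
    Finset.sum_congr rfl (g := fun _ => ((Om d).card : ℝ)), Finset.sum_const, nsmul_eq_mul]
  rintro ⟨x, y⟩ hA
  have hxy : x ≠ y := by
    rintro rfl; exact lt_irrefl _ (mem_fl.1 hA).2.2
  rw [sy_Om.count' (Finset.notMem_empty x) (Finset.notMem_empty y) hxy]
  simp

lemma mean_N : ((Fintype.card (HE d) : ℝ) - 1) * ∑ σ ∈ Om d, (Ncount H σ : ℝ) =
    (fN H d).card * (Om d).card := by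
  simp only [Ncount_eq]
  rw [← dcount (Om d) (fN H d) (fun A σ => σ A.1 = A.2), Finset.mul_sum,
    Finset.sum_congr rfl (g := fun _ => ((Om d).card : ℝ)), Finset.sum_const, nsmul_eq_mul]
  rintro ⟨x, y⟩ hA
  have hxy : x ≠ y := by
    rintro rfl; exact lt_irrefl _ (mem_fl.1 hA).2.1
  rw [sy_Om.count' (Finset.notMem_empty x) (Finset.notMem_empty y) hxy]
  simp

lemma mean_M : ((Fintype.card (HE d) : ℝ) - 1) * ((Fintype.card (HE d) : ℝ) - 3) *
    ∑ σ ∈ Om d, (Mcount H σ : ℝ) = (fM H d).card * (Om d).card := by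
  simp only [Mcount_eq]
  rw [← dcount (Om d) (fM H d) (fun A σ => σ A.1.1 = A.1.2 ∧ σ A.2.1 = A.2.2), Finset.mul_sum,
    Finset.sum_congr rfl (g := fun _ => ((Om d).card : ℝ)), Finset.sum_const, nsmul_eq_mul]
  rintro ⟨⟨x₁, y₁⟩, ⟨x, y⟩⟩ hA
  obtain ⟨n1, n2, n3, n4, n5, n6⟩ := fM_facts hA
  rw [sy_Om.count' (Finset.notMem_empty x₁) (Finset.notMem_empty y₁) n1,
    (sy_Om.filter (x := x₁) (y := y₁)).count' (x := x) (y := y) (by simp [n3, n4])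
      (by simp [n5, n6]) n2, card_V1 n1, fl_fl]
  push_cast; simp only [Finset.card_empty, Nat.cast_zero]
  ring

end Stein

section Sizes

variable {n : ℕ} {d : Fin n → ℕ} {H : SimpleGraph (Fin n)}

/-- indicator -/
noncomputable def ind (P : Prop) : ℝ := if P then 1 else 0

lemma ind_pos {P : Prop} (h : P) : ind P = 1 := if_pos h
lemma ind_neg {P : Prop} (h : ¬ P) : ind P = 0 := if_neg h
lemma ind_nonneg (P : Prop) : 0 ≤ ind P := by unfold ind; split_ifs <;> norm_num

lemma sum_ind_eq {α : Type*} [Fintype α] (f : α → ℝ) (u : α) :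
    ∑ v, f v * ind (v = u) = f u := by
  rw [Finset.sum_eq_single u, ind_pos rfl, mul_one]
  · intro b _ hb; rw [ind_neg hb, mul_zero]
  · intro h; exact absurd (Finset.mem_univ _) h

lemma sum_ind_eq' {α : Type*} [Fintype α] (f : α → ℝ) (u : α) :
    ∑ v, f v * ind (u = v) = f u := by
  simp only [eq_comm (a := u)]; exact sum_ind_eq f u

lemma mul_ind (P : Prop) (a : ℝ) : a * ind P = if P then a else 0 := by
  unfold ind; split_ifs <;> simp

lemma card_HE : (Fintype.card (HE d) : ℝ) = ∑ i, (d i : ℝ) := by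
  rw [Fintype.card_sigma]; simp

lemma sum_HE (f : Fin n → ℝ) : ∑ x : HE d, f x.1 = ∑ u, (d u : ℝ) * f u := by
  rw [Fintype.sum_sigma]; simp

lemma card_fl_sum {α : Type*} [Fintype α] (P : α → Prop) :
    ((fl Finset.univ P).card : ℝ) = ∑ x, ind (P x) := by
  unfold ind; exact (sum_fl P _).symm

lemma card_vertex (u : Fin n) :
    ((fl Finset.univ (fun x : HE d => x.1 = u)).card : ℝ) = d u := by
  rw [card_fl_sum, sum_HE (fun v => ind (v = u)), sum_ind_eq]

lemma card_nbr (u : Fin n) :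
    ((fl Finset.univ (fun x : HE d => H.Adj u x.1)).card : ℝ) =
      ∑ v, if H.Adj u v then (d v : ℝ) else 0 := by
  rw [card_fl_sum, sum_HE (fun v => ind (H.Adj u v))]; simp only [mul_ind]

lemma card_same : ((fl Finset.univ (fun x : HE d × HE d => x.1.1 = x.2.1)).card : ℝ) =
    ∑ i, (d i : ℝ) ^ 2 := by
  rw [card_fl_sum, Fintype.sum_prod_type]
  have : ∀ x : HE d, ∑ y : HE d, (ind (x.1 = y.1)) = d x.1 := by
    intro x
    rw [sum_HE (fun v => ind (x.1 = v)), sum_ind_eq']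
  simp only [this]
  rw [sum_HE (fun u => (d u : ℝ))]
  exact Finset.sum_congr rfl fun _ _ => by ring

lemma HE_ext {x y : HE d} (h1 : x.1 = y.1) (h2 : (x.2 : ℕ) = (y.2 : ℕ)) : x = y := by
  obtain ⟨u, i⟩ := x
  obtain ⟨v, j⟩ := y
  dsimp only at h1
  subst h1
  congr 1
  exact Fin.ext h2

lemma sum_swap {α : Type*} [Fintype α] (f : α × α → ℝ) : ∑ p : α × α, f p.swap = ∑ p, f p :=
  Equiv.sum_comp (Equiv.prodComm α α) f

/-- same vertex, different half-edges -/
def lp (p : HE d × HE d) : Prop := p.1.1 = p.2.1 ∧ (p.1.2 : ℕ) ≠ (p.2.2 : ℕ)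

lemma sum_lp : ∑ p : HE d × HE d, (ind (lp p)) = 2 * (fL d).card := by
  have e : ∀ p : HE d × HE d, (ind (lp p)) =
      (ind (p.1.1 = p.2.1 ∧ (p.1.2 : ℕ) < (p.2.2 : ℕ))) +
      (ind (p.swap.1.1 = p.swap.2.1 ∧ (p.swap.1.2 : ℕ) < (p.swap.2.2 : ℕ))) := by
    rintro ⟨x, y⟩
    simp only [lp, Prod.swap]
    by_cases h : x.1 = y.1
    · rcases lt_trichotomy (x.2 : ℕ) (y.2 : ℕ) with h1 | h1 | h1
      · simp [ind, h, h1, h1.ne, h1.le]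
      · simp [ind, h, h1]
      · simp [ind, h, h1, h1.ne', h1.le]
    · simp [ind, h, Ne.symm h]
  simp only [e]
  rw [Finset.sum_add_distrib,
    sum_swap (fun p : HE d × HE d => ind (p.1.1 = p.2.1 ∧ (p.1.2 : ℕ) < (p.2.2 : ℕ))),
    fL, card_fl_sum]
  ring

lemma card_fL : 2 * ((fL d).card : ℝ) = ∑ i, (d i : ℝ) ^ 2 - ∑ i, (d i : ℝ) := by
  rw [← sum_lp, ← card_same, card_fl_sum, ← card_HE]
  have h1 : (Fintype.card (HE d) : ℝ) = ∑ p : HE d × HE d, ind (p.1 = p.2) := by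
    rw [Fintype.sum_prod_type]
    have : ∀ x : HE d, ∑ y : HE d, ind (x = y) = 1 := fun x => by
      simpa using sum_ind_eq' (fun _ => (1:ℝ)) x
    simp [this]
  rw [h1, ← Finset.sum_sub_distrib]
  refine Finset.sum_congr rfl ?_
  rintro ⟨x, y⟩ _
  simp only [lp]
  by_cases h : x.1 = y.1
  · by_cases h2 : (x.2 : ℕ) = (y.2 : ℕ)
    · have := HE_ext h h2; subst this; simp [ind]
    · have : x ≠ y := by rintro rfl; exact h2 rfl
      simp [ind, h, h2, this]
  · have : x ≠ y := by rintro rfl; exact h rfl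
    simp [ind, h, this]

lemma sum_adj : ∑ p : HE d × HE d, (ind (H.Adj p.1.1 p.2.1)) =
    2 * (fN H d).card := by
  have e : ∀ p : HE d × HE d, (ind (H.Adj p.1.1 p.2.1)) =
      (ind (p.1.1 < p.2.1 ∧ H.Adj p.1.1 p.2.1)) +
      (ind (p.swap.1.1 < p.swap.2.1 ∧ H.Adj p.swap.1.1 p.swap.2.1)) := by
    rintro ⟨x, y⟩
    simp only [Prod.swap]
    by_cases h : H.Adj x.1 y.1
    · rcases lt_trichotomy x.1 y.1 with h1 | h1 | h1
      · simp [ind, h, h1, h1.le, h.symm]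
      · exact absurd h1 h.ne
      · simp [ind, h, h1, h1.le, h.symm]
    · have : ¬ H.Adj y.1 x.1 := fun h' => h h'.symm
      simp [ind, h, this]
  simp only [e]
  rw [Finset.sum_add_distrib,
    sum_swap (fun p : HE d × HE d => ind (p.1.1 < p.2.1 ∧ H.Adj p.1.1 p.2.1)),
    fN, card_fl_sum]
  ring

lemma card_fN : 2 * ((fN H d).card : ℝ) =
    ∑ x : Fin n × Fin n, if H.Adj x.1 x.2 then (d x.1 : ℝ) * (d x.2) else 0 := by
  rw [← sum_adj, Fintype.sum_prod_type, Fintype.sum_prod_type]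
  have : ∀ x : HE d, ∑ y : HE d, (ind (H.Adj x.1 y.1)) =
      ∑ v, if H.Adj x.1 v then (d v : ℝ) else 0 := by
    intro x
    rw [sum_HE (fun v => ind (H.Adj x.1 v))]; simp only [mul_ind]
  simp only [this]
  rw [sum_HE (fun u => ∑ v, if H.Adj u v then (d v : ℝ) else 0)]
  refine Finset.sum_congr rfl fun u _ => ?_
  rw [Finset.mul_sum]
  exact Finset.sum_congr rfl fun v _ => by simp

/-- membership in the double edge family -/
def Mp (H : SimpleGraph (Fin n)) (x : (HE d × HE d) × (HE d × HE d)) : Prop :=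
  x.1.1.1 = x.2.1.1 ∧ x.1.2.1 = x.2.2.1 ∧ x.1.1.1 < x.1.2.1 ∧
    ¬ H.Adj x.1.1.1 x.1.2.1 ∧
    (x.1.1.2 : ℕ) < (x.2.1.2 : ℕ) ∧ (x.1.2.2 : ℕ) ≠ (x.2.2.2 : ℕ)

/-- symmetrized version -/
def Fp (H : SimpleGraph (Fin n)) (x : (HE d × HE d) × (HE d × HE d)) : Prop :=
  lp (x.1.1, x.2.1) ∧ lp (x.1.2, x.2.2) ∧ x.1.1.1 ≠ x.1.2.1 ∧ ¬ H.Adj x.1.1.1 x.1.2.1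

lemma Fp_split (x y z w : HE d) : (ind (Fp H ((x, y), (z, w)))) =
    (ind (Mp H ((x, y), (z, w)))) + (ind (Mp H ((z, w), (x, y)))) +
    ((ind (Mp H ((y, x), (w, z)))) + (ind (Mp H ((w, z), (y, x))))) := by
  unfold Fp Mp lp
  dsimp only
  by_cases h1 : x.1 = z.1
  swap
  · simp [ind, h1, Ne.symm h1]
  by_cases h2 : y.1 = w.1
  swap
  · simp [ind, h2, Ne.symm h2]
  have h1' := h1.symm
  have h2' := h2.symm
  simp only [h1', h2']
  by_cases h3 : H.Adj x.1 y.1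
  · simp [ind, h3, h3.symm]
  have h3' : ¬ H.Adj y.1 x.1 := fun h => h3 h.symm
  simp only [h3, h3', true_and, not_false_eq_true, and_true]
  rcases lt_trichotomy x.1 y.1 with h4 | h4 | h4
  · have h5 : ¬ y.1 < x.1 := h4.asymm
    simp only [h4, h5, h4.ne, true_and, false_and, and_true, ne_eq, not_false_eq_true]
    rcases lt_trichotomy (x.2 : ℕ) (z.2 : ℕ) with h6 | h6 | h6
    · simp [ind, h6, h6.ne, h6.le]
    · simp [ind, h6]
    · simp [ind, h6, h6.ne', h6.le, eq_comm]
  · simp [ind, h4]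
  · have h5 : ¬ x.1 < y.1 := h4.asymm
    simp only [h4, h5, h4.ne', true_and, false_and, and_true, ne_eq, not_false_eq_true]
    rcases lt_trichotomy (y.2 : ℕ) (w.2 : ℕ) with h6 | h6 | h6
    · simp [ind, h6, h6.ne, h6.le]
    · simp [ind, h6]
    · simp [ind, h6, h6.ne', h6.le, eq_comm]

lemma card_fM4 : 4 * ((fM H d).card : ℝ) =
    ∑ p : (HE d × HE d) × (HE d × HE d), ind (Fp H p) := by
  set f : (HE d × HE d) × (HE d × HE d) → ℝ := fun p => ind (Mp H p) with hf
  have h0 : ((fM H d).card : ℝ) = ∑ p, f p := card_fl_sum _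
  have h1 : ∑ p : (HE d × HE d) × (HE d × HE d), f p.swap = ∑ p, f p := sum_swap f
  have h2 : ∀ g : (HE d × HE d) × (HE d × HE d) → ℝ, 
      ∑ p : (HE d × HE d) × (HE d × HE d), g (p.1.swap, p.2.swap) = ∑ p, g p :=
    fun g => Equiv.sum_comp (Equiv.prodCongr (Equiv.prodComm _ _) (Equiv.prodComm _ _)) g
  have h3 := h2 f
  have h4 := h2 (fun p : (HE d × HE d) × (HE d × HE d) => f p.swap)
  have : ∑ p : (HE d × HE d) × (HE d × HE d), (ind (Fp H p)) =
      ∑ p : (HE d × HE d) × (HE d × HE d), (f p + f p.swap +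
        (f (p.1.swap, p.2.swap) + f (Prod.swap (p.1.swap, p.2.swap)))) := by
    refine Finset.sum_congr rfl ?_
    rintro ⟨⟨x, y⟩, ⟨z, w⟩⟩ _
    exact Fp_split x y z w
  rw [this, Finset.sum_add_distrib, Finset.sum_add_distrib, Finset.sum_add_distrib, h1, h3, h4, h1,
    h0]
  ring

lemma sum_four (f g : HE d × HE d → ℝ) :
    ∑ p : (HE d × HE d) × (HE d × HE d), f (p.1.1, p.2.1) * g (p.1.2, p.2.2) =
      (∑ q, f q) * ∑ q, g q := by
  rw [Finset.sum_mul_sum, ← Fintype.sum_prod_type' (f := fun a b => f a * g b)]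
  exact Equiv.sum_comp (Equiv.prodProdProdComm (HE d) (HE d) (HE d) (HE d))
    (fun q => f q.1 * g q.2)

lemma ind_aux1 (A B C : Prop) : ind (A ∧ B ∧ C) ≤ ind A * ind B := by
  by_cases hA : A <;> by_cases hB : B <;> by_cases hC : C <;> simp [ind, hA, hB, hC]

lemma ind_aux2 (A B C E P Q : Prop) : ind (A ∧ P) * ind (B ∧ Q) ≤
    ind ((A ∧ P) ∧ (B ∧ Q) ∧ ¬ C ∧ ¬ E) + ind A * ind B * (ind C + ind E) := by
  by_cases hA : A <;> by_cases hB : B <;> by_cases hC : C <;> by_cases hE : E <;>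
    by_cases hP : P <;> by_cases hQ : Q <;> simp [ind, hA, hB, hC, hE, hP, hQ]

lemma card_fM_le : 4 * ((fM H d).card : ℝ) ≤ (2 * ((fL d).card : ℝ)) ^ 2 := by
  rw [card_fM4, ← sum_lp, sq, ← sum_four]
  refine Finset.sum_le_sum fun p _ => ?_
  unfold Fp
  exact ind_aux1 _ _ _

lemma sum_g_le {D : ℝ} (hD : ∀ u, (d u : ℝ) ≤ D) (g : HE d × HE d → ℝ) (hg : ∀ p, 0 ≤ g p) :
    ∑ p : (HE d × HE d) × (HE d × HE d), (ind (p.1.1.1 = p.2.1.1)) *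
      (ind (p.1.2.1 = p.2.2.1)) * g p.1 ≤ D ^ 2 * ∑ q, g q := by
  rw [Fintype.sum_prod_type, Finset.mul_sum]
  refine Finset.sum_le_sum fun q _ => ?_
  dsimp only
  rw [← Finset.sum_mul]
  refine mul_le_mul_of_nonneg_right ?_ (hg q)
  rw [Fintype.sum_prod_type]
  dsimp only
  rw [← Finset.sum_mul_sum]
  have : ∀ x : HE d, ∑ y : HE d, (ind (x.1 = y.1)) = d x.1 := by
    intro x
    rw [sum_HE (fun v => ind (x.1 = v)), sum_ind_eq']
  rw [this, this, sq]
  exact mul_le_mul (hD _) (hD _) (Nat.cast_nonneg _) (le_trans (Nat.cast_nonneg _) (hD q.1.1))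

lemma card_fM_ge {D : ℝ} (hD : ∀ u, (d u : ℝ) ≤ D) :
    (2 * ((fL d).card : ℝ)) ^ 2 - D ^ 2 * (∑ i, (d i : ℝ) ^ 2 + 2 * (fN H d).card) ≤
      4 * ((fM H d).card : ℝ) := by
  have h1 := sum_g_le hD (fun p => (ind (p.1.1 = p.2.1)) +
    (ind (H.Adj p.1.1 p.2.1))) (fun p => add_nonneg (ind_nonneg _) (ind_nonneg _))
  rw [Finset.sum_add_distrib, sum_adj, ← card_fl_sum, card_same] at h1
  have h2 : (2 * ((fL d).card : ℝ)) ^ 2 ≤ 4 * ((fM H d).card : ℝ) +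
      ∑ p : (HE d × HE d) × (HE d × HE d), (ind (p.1.1.1 = p.2.1.1)) *
      (ind (p.1.2.1 = p.2.2.1)) * ((ind (p.1.1.1 = p.1.2.1)) +
    (ind (H.Adj p.1.1.1 p.1.2.1))) := by
    rw [card_fM4, ← sum_lp, sq, ← sum_four, ← Finset.sum_add_distrib]
    refine Finset.sum_le_sum ?_
    rintro ⟨⟨x, y⟩, ⟨z, w⟩⟩ _
    exact ind_aux2 _ _ _ _ _ _
  linarith

lemma nbr_sq_le (u : Fin n) :
    (∑ v, if H.Adj u v then (d v : ℝ) else 0) ^ 2 ≤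
      (Nat.card {w : Fin n // H.Adj u w} : ℝ) * ∑ i, (d i : ℝ) ^ 2 := by
  have := Finset.sum_mul_sq_le_sq_mul_sq Finset.univ
    (fun v => ind (H.Adj u v)) (fun v => (d v : ℝ))
  have e1 : ∑ v, ind (H.Adj u v) * (d v : ℝ) = ∑ v, if H.Adj u v then (d v : ℝ) else 0 :=
    Finset.sum_congr rfl fun v _ => by rw [mul_comm, mul_ind]
  have e2 : ∑ v, ind (H.Adj u v) ^ 2 = (Nat.card {w : Fin n // H.Adj u w} : ℝ) := by
    rw [card_fl_univ, card_fl_sum]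
    exact Finset.sum_congr rfl fun v _ => by unfold ind; split_ifs <;> simp
  rwa [e1, e2] at this

lemma mkDB {D S : ℝ} (hD : ∀ u, (d u : ℝ) ≤ D) (hD0 : 0 ≤ D)
    (hS : ∀ u, (∑ v, if H.Adj u v then (d v : ℝ) else 0) ≤ S)
    (h7 : 7 < ∑ i, (d i : ℝ)) :
    DB (Sigma.fst : HE d → Fin n) H D S (∑ i, (d i : ℝ) ^ 2) (∑ i, (d i : ℝ) - 7) where
  hD u := by rw [card_vertex]; exact hD u
  hS u := by rw [card_nbr]; exact hS u
  hQ := card_same.le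
  hK := by rw [card_HE]
  hK0 := by linarith
  hD0 := hD0

lemma Om_pos (he : Even (∑ i, d i)) : 0 < (Om d).card := by
  obtain ⟨k, hk⟩ := he
  have hc : Fintype.card (HE d) = Fintype.card (Fin k × Bool) := by
    rw [Fintype.card_sigma]; simp [hk]; ring
  let e := Fintype.equivOfCardEq hc
  refine Finset.card_pos.2 ⟨fun x => e.symm ((e x).1, !(e x).2), mem_fl.2 ⟨Finset.mem_univ _, ?_, ?_⟩⟩
  · intro x; simp
  · intro x hx
    have := congrArg (fun y => (e y).2) hx
    simp at this

end Sizes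

section Limits

lemma lim_congr_pos {f g : ℕ → ℝ} {x : ℝ} (hf : Tendsto f atTop (nhds x))
    (h : ∀ n : ℕ, (0:ℝ) < n → f n = g n) : Tendsto g atTop (nhds x) := by
  refine hf.congr' ?_
  filter_upwards [eventually_gt_atTop 0] with n hn
  exact h n (by exact_mod_cast hn)

lemma one_div_lim : Tendsto (fun n : ℕ => 1 / (n : ℝ)) atTop (nhds 0) :=
  tendsto_one_div_atTop_nhds_zero_nat

lemma sub_const_lim {m : ℕ → ℝ} {κ : ℝ} (c : ℝ) (hm : Tendsto (fun n => m n / n) atTop (nhds κ)) :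
    Tendsto (fun n => (m n - c) / n) atTop (nhds κ) := by
  have := hm.sub (one_div_lim.const_mul c)
  rw [mul_zero, sub_zero] at this
  refine this.congr fun n => ?_
  ring

lemma ratio_lim {x y : ℕ → ℝ} {a b : ℝ} (hb : 0 < b)
    (hx : Tendsto (fun n => x n / n) atTop (nhds a))
    (hy : Tendsto (fun n => y n / n) atTop (nhds b)) :
    Tendsto (fun n => x n / y n) atTop (nhds (a / b)) := by
  refine lim_congr_pos (hx.div hy hb.ne') fun n hn => ?_
  rw [Pi.div_apply, div_div_div_cancel_right₀ hn.ne']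

lemma epsA_lim {D S Q K : ℕ → ℝ} {κ θ : ℝ} (hκ : 0 < κ)
    (hD : Tendsto (fun n => D n / n) atTop (nhds 0))
    (hS : Tendsto (fun n => S n / n) atTop (nhds 0))
    (hQ : Tendsto (fun n => Q n / n) atTop (nhds θ))
    (hK : Tendsto (fun n => K n / n) atTop (nhds κ)) :
    Tendsto (fun n => epsA (D n) (S n) (Q n) (K n)) atTop (nhds 0) := by
  have h1 := ratio_lim hκ hD hK
  have h2 := ratio_lim hκ hS hK
  have h3 := ratio_lim hκ hQ hK
  have := ((h1.const_mul 5).add h2).add (h1.mul h3)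
  simp only [zero_div, mul_zero, zero_mul, add_zero] at this
  refine this.congr fun n => ?_
  unfold epsA
  ring

lemma epsT_lim {m D S Q K : ℕ → ℝ} {κ θ : ℝ} (hκ : 0 < κ)
    (hD : Tendsto (fun n => D n / n) atTop (nhds 0))
    (hD2 : Tendsto (fun n => D n ^ 2 / n) atTop (nhds 0))
    (hS : Tendsto (fun n => S n / n) atTop (nhds 0))
    (hQ : Tendsto (fun n => Q n / n) atTop (nhds θ))
    (hm : Tendsto (fun n => m n / n) atTop (nhds κ))
    (hK : Tendsto (fun n => K n / n) atTop (nhds κ)) :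
    Tendsto (fun n => epsT (m n) (D n) (S n) (Q n) (K n)) atTop (nhds 0) := by
  have h0 := epsA_lim hκ hD hS hQ hK
  have h1 := ratio_lim hκ hD2 hK
  have h2 := ratio_lim hκ hm hK
  have h3 := ratio_lim hκ (x := fun _ => 1) one_div_lim hK
  have := ((h0.const_mul 2).add (h3.add (h2.mul h0))).add h1
  simp only [zero_div, mul_zero, add_zero] at this
  refine this.congr fun n => ?_
  unfold epsT
  ring

lemma sup_lim (f : (n : ℕ) → Fin n → ℝ) (h0 : ∀ n i, 0 ≤ f n i)
    (h : ∀ ε : ℝ, 0 < ε → ∀ᶠ n : ℕ in atTop, ∀ i, f n i ≤ ε * n) :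
    ∃ g : ℕ → ℝ, (∀ n i, f n i ≤ g n) ∧ (∀ n, 0 ≤ g n) ∧
      Tendsto (fun n => g n / n) atTop (nhds 0) := by
  have hg0 : ∀ n, 0 ≤ ⨆ i, f n i := fun n => Real.iSup_nonneg (h0 n)
  refine ⟨fun n => ⨆ i, f n i, fun n i => le_ciSup (Set.finite_range _).bddAbove i, hg0, ?_⟩
  rw [Metric.tendsto_nhds]
  intro ε hε
  filter_upwards [h (ε / 2) (by positivity), eventually_gt_atTop 0] with n hn hn0
  have hn0' : (0:ℝ) < n := by exact_mod_cast hn0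
  rw [Real.dist_eq, sub_zero, abs_of_nonneg (div_nonneg (hg0 n) hn0'.le), div_lt_iff₀ hn0']
  have : (⨆ i, f n i) ≤ ε / 2 * n := Real.iSup_le hn (by positivity)
  nlinarith

lemma rec_lim {x y l e : ℕ → ℝ} {lam : ℝ} (hl : Tendsto l atTop (nhds lam))
    (he : Tendsto e atTop (nhds 0)) (hy0 : ∀ n, 0 ≤ y n) (hy1 : ∀ n, y n ≤ 1)
    (h : ∀ᶠ n in atTop, |x n - l n * y n| ≤ l n * e n) :
    Tendsto (fun n => x n - lam * y n) atTop (nhds 0) := by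
  have h1 : Tendsto (fun n => l n * e n + |l n - lam|) atTop (nhds 0) := by
    have := (hl.mul he).add (hl.sub_const lam).abs
    simpa using this
  refine squeeze_zero_norm' ?_ h1
  filter_upwards [h] with n hn
  rw [Real.norm_eq_abs]
  have e1 : x n - lam * y n = (x n - l n * y n) + (l n - lam) * y n := by ring
  rw [e1]
  refine (abs_add_le _ _).trans (add_le_add hn ?_)
  rw [abs_mul, abs_of_nonneg (hy0 n)]
  exact mul_le_of_le_one_right (abs_nonneg _) (hy1 n)

end Limits

section Degrees

variable {dseq : (n : ℕ) → Fin n → ℕ} {p : ℕ → ℝ}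

lemma trunc_sum (n K : ℕ) (f : ℕ → ℝ) :
    ∑ i, f (dseq n i) * ind (dseq n i < K) =
      ∑ k ∈ Finset.range K, f k * (Nat.card {i : Fin n // dseq n i = k} : ℝ) := by
  simp only [card_fl_univ, card_fl_sum, Finset.mul_sum]
  rw [Finset.sum_comm]
  refine Finset.sum_congr rfl fun i _ => ?_
  by_cases h : dseq n i < K
  · rw [ind_pos h, Finset.sum_eq_single_of_mem (dseq n i) (Finset.mem_range.2 h), ind_pos rfl]
    intro b _ hb
    rw [ind_neg (Ne.symm hb), mul_zero]
  · rw [ind_neg h, mul_zero, Finset.sum_eq_zero]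
    intro k hk
    rw [ind_neg, mul_zero]
    rintro rfl
    exact h (Finset.mem_range.1 hk)

lemma trunc_lim (hpconv : ∀ k : ℕ, Tendsto
      (fun n => (Nat.card {i : Fin n // dseq n i = k} : ℝ) / n) atTop (nhds (p k)))
    (K : ℕ) (f : ℕ → ℝ) :
    Tendsto (fun n : ℕ => (∑ i, f (dseq n i) * ind (dseq n i < K)) / n) atTop
      (nhds (∑ k ∈ Finset.range K, f k * p k)) := by
  have := tendsto_finsetSum (Finset.range K) (fun k _ => (hpconv k).const_mul (f k))
  refine this.congr fun n => ?_
  rw [trunc_sum, Finset.sum_div]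
  exact Finset.sum_congr rfl fun k _ => by ring

lemma split_sum (n K : ℕ) (f : ℕ → ℝ) : ∑ i, f (dseq n i) =
    ∑ i, f (dseq n i) * ind (dseq n i < K) + ∑ i, f (dseq n i) * ind (K ≤ dseq n i) := by
  rw [← Finset.sum_add_distrib]
  refine Finset.sum_congr rfl fun i _ => ?_
  by_cases h : dseq n i < K
  · rw [ind_pos h, ind_neg (not_le.2 h)]; ring
  · rw [ind_neg h, ind_pos (not_lt.1 h)]; ring

lemma tail (hpconv : ∀ k : ℕ, Tendsto
      (fun n => (Nat.card {i : Fin n // dseq n i = k} : ℝ) / n) atTop (nhds (p k)))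
    {μ2 : ℝ} (hμ2 : HasSum (fun k : ℕ => (k : ℝ) ^ 2 * p k) μ2)
    (hμ2conv : Tendsto (fun n => (∑ i, (dseq n i : ℝ) ^ 2) / n) atTop (nhds μ2))
    {ε : ℝ} (hε : 0 < ε) : ∀ᶠ K in atTop, ∀ᶠ n : ℕ in atTop,
      (∑ i, (dseq n i : ℝ) ^ 2 * ind (K ≤ dseq n i)) ≤ ε * n := by
  filter_upwards [hμ2.tendsto_sum_nat.eventually (lt_mem_nhds (show μ2 - ε < μ2 by linarith))]
    with K hK
  have h1 := hμ2conv.sub (trunc_lim hpconv K (fun k => (k:ℝ) ^ 2))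
  filter_upwards [h1.eventually (gt_mem_nhds (show _ < ε by linarith)), eventually_gt_atTop 0]
    with n hn hn0
  have hn0' : (0:ℝ) < n := by exact_mod_cast hn0
  have h2 := split_sum (dseq := dseq) n K (fun k => (k:ℝ) ^ 2)
  rw [← sub_div, div_lt_iff₀ hn0'] at hn
  linarith

lemma maxdeg_lim (hpconv : ∀ k : ℕ, Tendsto
      (fun n => (Nat.card {i : Fin n // dseq n i = k} : ℝ) / n) atTop (nhds (p k)))
    {μ2 : ℝ} (hμ2 : HasSum (fun k : ℕ => (k : ℝ) ^ 2 * p k) μ2)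
    (hμ2conv : Tendsto (fun n => (∑ i, (dseq n i : ℝ) ^ 2) / n) atTop (nhds μ2)) :
    ∃ D : ℕ → ℝ, (∀ n i, (dseq n i : ℝ) ≤ D n) ∧ (∀ n, 0 ≤ D n) ∧
      Tendsto (fun n => D n / n) atTop (nhds 0) ∧
      Tendsto (fun n => D n ^ 2 / n) atTop (nhds 0) := by
  obtain ⟨g, hg, hg0, hgl⟩ := sup_lim (fun n i => (dseq n i : ℝ) ^ 2) (fun n i => by positivity) (by
    intro ε hε
    obtain ⟨K, hK⟩ := (tail hpconv hμ2 hμ2conv (half_pos hε)).exists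
    have h1 : ∀ᶠ n : ℕ in atTop, (K:ℝ) ^ 2 / (ε / 2) ≤ n :=
      tendsto_natCast_atTop_atTop.eventually_ge_atTop _
    filter_upwards [hK, h1] with n h2 h3 i
    rw [div_le_iff₀ (half_pos hε)] at h3
    by_cases h : K ≤ dseq n i
    · have h4 := Finset.single_le_sum (f := fun i => (dseq n i : ℝ) ^ 2 * ind (K ≤ dseq n i))
        (fun i _ => mul_nonneg (by positivity) (ind_nonneg _)) (Finset.mem_univ i)
      rw [ind_pos h, mul_one] at h4
      nlinarith [sq_nonneg (K:ℝ)]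
    · have h4 : (dseq n i : ℝ) ≤ K := by exact_mod_cast (not_le.1 h).le
      have h5 : (dseq n i : ℝ) ^ 2 ≤ (K:ℝ) ^ 2 := pow_le_pow_left₀ (Nat.cast_nonneg _) h4 2
      have : (0:ℝ) ≤ n := Nat.cast_nonneg _
      nlinarith)
  refine ⟨fun n => Real.sqrt (g n), fun n i => Real.le_sqrt_of_sq_le (hg n i),
    fun n => Real.sqrt_nonneg _, ?_, ?_⟩
  · have := (Real.continuous_sqrt.tendsto _).comp (hgl.mul one_div_lim)
    rw [mul_zero, Real.sqrt_zero] at this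
    refine this.congr fun n => ?_
    have hn : (0:ℝ) ≤ n := Nat.cast_nonneg _
    show Real.sqrt (g n / n * (1 / n)) = _
    rw [show g n / n * (1 / n) = g n / (n:ℝ) ^ 2 by ring, Real.sqrt_div (hg0 n), Real.sqrt_sq hn]
  · simpa only [Real.sq_sqrt (hg0 _)] using hgl

lemma mu1_summable (hpnn : ∀ k, 0 ≤ p k)
    {μ2 : ℝ} (hμ2 : HasSum (fun k : ℕ => (k : ℝ) ^ 2 * p k) μ2) :
    Summable (fun k : ℕ => (k:ℝ) * p k) := by
  refine Summable.of_nonneg_of_le (fun k => mul_nonneg (Nat.cast_nonneg _) (hpnn k)) (fun k => ?_)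
    hμ2.summable
  refine mul_le_mul_of_nonneg_right ?_ (hpnn k)
  exact_mod_cast Nat.le_self_pow two_ne_zero k

lemma mu1_pos (hpnn : ∀ k, 0 ≤ p k) (hp1 : HasSum p 1) (hp0 : p 0 < 1)
    {μ2 : ℝ} (hμ2 : HasSum (fun k : ℕ => (k : ℝ) ^ 2 * p k) μ2) : 0 < mu1 p := by
  have h1 : HasSum (fun k => (if k = 0 then 0 else p k)) (1 - p 0) := by
    have := hp1.sub (hasSum_ite_eq 0 (p 0))
    refine this.congr_fun ?_
    intro k
    by_cases h : k = 0 <;> simp [h]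
  have h2 := h1.tsum_eq
  have : 1 - p 0 ≤ mu1 p := by
    rw [← h2]
    refine h1.summable.tsum_le_tsum (fun k => ?_) (mu1_summable hpnn hμ2)
    by_cases h : k = 0
    · simp [h]
    · rw [if_neg h]
      have : (1:ℝ) ≤ k := by exact_mod_cast Nat.one_le_iff_ne_zero.2 h
      nlinarith [hpnn k]
  linarith

lemma sumdeg_lim (hpnn : ∀ k, 0 ≤ p k) (hpconv : ∀ k : ℕ, Tendsto
      (fun n => (Nat.card {i : Fin n // dseq n i = k} : ℝ) / n) atTop (nhds (p k)))
    {μ2 : ℝ} (hμ2 : HasSum (fun k : ℕ => (k : ℝ) ^ 2 * p k) μ2)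
    (hμ2conv : Tendsto (fun n => (∑ i, (dseq n i : ℝ) ^ 2) / n) atTop (nhds μ2)) :
    Tendsto (fun n => (∑ i, (dseq n i : ℝ)) / n) atTop (nhds (mu1 p)) := by
  rw [Metric.tendsto_nhds]
  intro ε hε
  have hs : HasSum (fun k : ℕ => (k:ℝ) * p k) (mu1 p) := (mu1_summable hpnn hμ2).hasSum
  obtain ⟨K, hK1, hK2⟩ := ((tail hpconv hμ2 hμ2conv (show 0 < ε / 4 by positivity)).and
    (hs.tendsto_sum_nat.eventually (lt_mem_nhds (show mu1 p - ε / 4 < mu1 p by linarith)))).exists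
  have hK3 : ∑ k ∈ Finset.range K, (k:ℝ) * p k ≤ mu1 p :=
    sum_le_hasSum _ (fun k _ => mul_nonneg (Nat.cast_nonneg _) (hpnn k)) hs
  have h1 := (Metric.tendsto_nhds.1 (trunc_lim hpconv K (fun k => (k:ℝ)))) (ε / 4) (by positivity)
  filter_upwards [hK1, h1, eventually_gt_atTop 0] with n h2 h3 hn0
  have hn0' : (0:ℝ) < n := by exact_mod_cast hn0
  rw [split_sum n K (fun k => (k:ℝ)), add_div]
  have h4 : (∑ i, (dseq n i : ℝ) * ind (K ≤ dseq n i)) / n ≤ ε / 4 := by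
    rw [div_le_iff₀ hn0']
    refine le_trans (Finset.sum_le_sum fun i _ => ?_) h2
    refine mul_le_mul_of_nonneg_right ?_ (ind_nonneg _)
    exact_mod_cast Nat.le_self_pow two_ne_zero _
  have h5 : 0 ≤ (∑ i, (dseq n i : ℝ) * ind (K ≤ dseq n i)) / n :=
    div_nonneg (Finset.sum_nonneg fun i _ => mul_nonneg (Nat.cast_nonneg _) (ind_nonneg _)) hn0'.le
  rw [Real.dist_eq, abs_lt] at h3 ⊢
  constructor <;> linarith

lemma nbr_lim {hseq : (n : ℕ) → SimpleGraph (Fin n)}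
    (hmaxdeg : ∀ ε : ℝ, 0 < ε → ∀ᶠ n in atTop, ∀ v : Fin n,
      (Nat.card {w : Fin n // (hseq n).Adj v w} : ℝ) ≤ ε * n)
    {μ2 : ℝ} (hμ0 : 0 ≤ μ2)
    (hμ2conv : Tendsto (fun n => (∑ i, (dseq n i : ℝ) ^ 2) / n) atTop (nhds μ2)) :
    ∃ S : ℕ → ℝ, (∀ n u, (∑ v, if (hseq n).Adj u v then (dseq n v : ℝ) else 0) ≤ S n) ∧
      (∀ n, 0 ≤ S n) ∧ Tendsto (fun n => S n / n) atTop (nhds 0) := by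
  refine sup_lim (fun n u => ∑ v, if (hseq n).Adj u v then (dseq n v : ℝ) else 0)
    (fun n u => Finset.sum_nonneg fun v _ => by split_ifs <;> positivity) ?_
  intro ε hε
  filter_upwards [hmaxdeg (ε ^ 2 / (μ2 + 1)) (by positivity),
    hμ2conv.eventually (gt_mem_nhds (show μ2 < μ2 + 1 by linarith)), eventually_gt_atTop 0]
    with n h1 h2 hn0 u
  have hn0' : (0:ℝ) < n := by exact_mod_cast hn0
  rw [div_lt_iff₀ hn0'] at h2
  have h3 := nbr_sq_le (d := dseq n) (H := hseq n) u
  have h4 : (Nat.card {w : Fin n // (hseq n).Adj u w} : ℝ) * ∑ i, (dseq n i : ℝ) ^ 2 ≤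
      (ε ^ 2 / (μ2 + 1) * n) * ((μ2 + 1) * n) :=
    mul_le_mul (h1 u) h2.le (Finset.sum_nonneg fun i _ => by positivity) (by positivity)
  have h5 : (ε ^ 2 / (μ2 + 1) * n) * ((μ2 + 1) * n) = (ε * n) ^ 2 := by field_simp
  exact (le_abs_self _).trans (abs_le_of_sq_le_sq (h3.trans (h4.trans h5.le)) (by positivity))

end Degrees

section Analytic

/-- unnormalized product Poisson weights -/
noncomputable def qw (l1 l2 l3 : ℝ) (v : ℕ × ℕ × ℕ) : ℝ :=
  l1 ^ v.1 / v.1.factorial * (l2 ^ v.2.1 / v.2.1.factorial * (l3 ^ v.2.2 / v.2.2.factorial))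

lemma exp_hasSum (l : ℝ) : HasSum (fun k : ℕ => l ^ k / k.factorial) (Real.exp l) := by
  rw [Real.exp_eq_exp_ℝ]; exact NormedSpace.expSeries_div_hasSum_exp l

lemma qw_nonneg {l1 l2 l3 : ℝ} (h1 : 0 ≤ l1) (h2 : 0 ≤ l2) (h3 : 0 ≤ l3) (v) :
    0 ≤ qw l1 l2 l3 v := by unfold qw; positivity

lemma qw_hasSum {l1 l2 l3 : ℝ} (h1 : 0 ≤ l1) (h2 : 0 ≤ l2) (h3 : 0 ≤ l3) :
    HasSum (qw l1 l2 l3) (Real.exp l1 * (Real.exp l2 * Real.exp l3)) := by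
  have n : ∀ l : ℝ, 0 ≤ l → 0 ≤ (fun k : ℕ => l ^ k / k.factorial) :=
    fun l hl k => by positivity
  have a := (exp_hasSum l2).mul (exp_hasSum l3)
    ((exp_hasSum l2).summable.mul_of_nonneg (exp_hasSum l3).summable (n _ h2) (n _ h3))
  have b := (exp_hasSum l1).mul a
    ((exp_hasSum l1).summable.mul_of_nonneg a.summable (n _ h1)
      (fun k => mul_nonneg (n _ h2 _) (n _ h3 _)))
  exact b

lemma poi_eq (l1 l2 l3 : ℝ) (v : ℕ × ℕ × ℕ) :
    poiP l1 v.1 * poiP l2 v.2.1 * poiP l3 v.2.2 =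
      (Real.exp l1 * (Real.exp l2 * Real.exp l3))⁻¹ * qw l1 l2 l3 v := by
  unfold poiP qw
  rw [Real.exp_neg, Real.exp_neg, Real.exp_neg]
  field_simp

lemma step_lim {P Q R : ℕ → ℝ} {l q : ℝ} {a : ℕ}
    (h : Tendsto (fun n => ((a + 1 : ℕ) : ℝ) * P n - l * Q n) atTop (nhds 0))
    (hQ : Tendsto (fun n => Q n - R n * q) atTop (nhds 0)) :
    Tendsto (fun n => P n - R n * (l / ((a + 1 : ℕ) : ℝ) * q)) atTop (nhds 0) := by
  have ha : ((a + 1 : ℕ) : ℝ) ≠ 0 := by positivity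
  have := (h.const_mul (((a + 1 : ℕ) : ℝ)⁻¹)).add (hQ.const_mul (l / ((a + 1 : ℕ) : ℝ)))
  simp only [mul_zero, add_zero] at this
  refine this.congr fun n => ?_
  field_simp
  ring

theorem analytic (P : ℕ → ℕ × ℕ × ℕ → ℝ) (hnn : ∀ n v, 0 ≤ P n v) (hsum : ∀ n, HasSum (P n) 1)
    {l1 l2 l3 : ℝ} (hl1 : 0 ≤ l1) (hl2 : 0 ≤ l2) (hl3 : 0 ≤ l3)
    (h1 : ∀ a b c, Tendsto (fun n => ((a + 1 : ℕ) : ℝ) * P n (a + 1, b, c) - l1 * P n (a, b, c))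
      atTop (nhds 0))
    (h2 : ∀ a b c, Tendsto (fun n => ((b + 1 : ℕ) : ℝ) * P n (a, b + 1, c) - l2 * P n (a, b, c))
      atTop (nhds 0))
    (h3 : ∀ a b c, Tendsto (fun n => ((c + 1 : ℕ) : ℝ) * P n (a, b, c + 1) - l3 * P n (a, b, c))
      atTop (nhds 0))
    (ht : ∀ ε : ℝ, 0 < ε → ∃ s : Finset (ℕ × ℕ × ℕ), ∀ᶠ n in atTop, 1 - ε ≤ ∑ v ∈ s, P n v) :
    Tendsto (fun n => ∑' v, |P n v - poiP l1 v.1 * poiP l2 v.2.1 * poiP l3 v.2.2|)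
      atTop (nhds 0) := by
  set Z := Real.exp l1 * (Real.exp l2 * Real.exp l3) with hZ
  have hZ0 : 0 < Z := by positivity
  have hq := qw_hasSum hl1 hl2 hl3
  have hq0 := qw_nonneg hl1 hl2 hl3
  set q := qw l1 l2 l3 with hqd
  simp only [poi_eq, ← hZ, ← hqd]
  set R : ℕ → ℝ := fun n => P n (0, 0, 0) with hR
  have key : ∀ a b c, Tendsto (fun n => P n (a, b, c) - R n * q (a, b, c)) atTop (nhds 0) := by
    intro a
    induction a with
    | zero =>
      intro b
      induction b with
      | zero =>
        intro c
        induction c with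
        | zero => simp [hqd, qw, hR]
        | succ c ih =>
          have := step_lim (h3 0 0 c) ih
          refine this.congr fun n => ?_
          simp only [hqd, qw, Nat.factorial_succ, Nat.cast_mul]
          field_simp
          ring
      | succ b ih =>
        intro c
        have := step_lim (h2 0 b c) (ih c)
        refine this.congr fun n => ?_
        simp only [hqd, qw, Nat.factorial_succ, Nat.cast_mul]
        field_simp
        ring
    | succ a ih =>
      intro b c
      have := step_lim (h1 a b c) (ih b c)
      refine this.congr fun n => ?_
      simp only [hqd, qw, Nat.factorial_succ, Nat.cast_mul]
      field_simp
      ring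
  have key' : ∀ v, Tendsto (fun n => P n v - R n * q v) atTop (nhds 0) := fun v => key _ _ _
  have hR0 : ∀ n, 0 ≤ R n := fun n => hnn n _
  have hR1 : ∀ n, R n ≤ 1 := fun n => by
    have := sum_le_hasSum {(0, 0, 0)} (fun v _ => hnn n v) (hsum n)
    simpa using this
  have hRZ : Tendsto (fun n => R n * Z) atTop (nhds 1) := by
    rw [Metric.tendsto_nhds]
    intro ε hε
    obtain ⟨s, hs⟩ := ht (ε / 4) (by positivity)
    have hq' : ∀ᶠ t in atTop, Z - ε / 4 < ∑ v ∈ t, q v :=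
      (show Tendsto (fun t : Finset (ℕ × ℕ × ℕ) => ∑ v ∈ t, q v) atTop (nhds Z) from hq).eventually
        (lt_mem_nhds (by linarith))
    obtain ⟨t, hst, htq⟩ := ((eventually_ge_atTop s).and hq').exists
    have hd : Tendsto (fun n => ∑ v ∈ t, (P n v - R n * q v)) atTop (nhds 0) := by
      simpa using tendsto_finsetSum t (fun v _ => key' v)
    have hd' := (Metric.tendsto_nhds.1 hd) (ε / 4) (by positivity)
    filter_upwards [hs, hd'] with n h1 h2
    have a1 : ∑ v ∈ s, P n v ≤ ∑ v ∈ t, P n v :=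
      Finset.sum_le_sum_of_subset_of_nonneg hst (fun v _ _ => hnn n v)
    have a2 : ∑ v ∈ t, P n v ≤ 1 := sum_le_hasSum t (fun v _ => hnn n v) (hsum n)
    have a3 : ∑ v ∈ t, q v ≤ Z := sum_le_hasSum t (fun v _ => hq0 v) hq
    rw [Finset.sum_sub_distrib, ← Finset.mul_sum, Real.dist_eq, sub_zero, abs_lt] at h2
    have a4 := mul_le_mul_of_nonneg_left a3 (hR0 n)
    have a5 := mul_le_mul_of_nonneg_left htq.le (hR0 n)
    have a6 : R n * (ε / 4) ≤ 1 * (ε / 4) := mul_le_mul_of_nonneg_right (hR1 n) (by positivity)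
    rw [Real.dist_eq, abs_lt]
    constructor <;> nlinarith
  have hRl : Tendsto R atTop (nhds Z⁻¹) := by
    have := hRZ.mul_const Z⁻¹
    rw [one_mul] at this
    refine this.congr fun n => ?_
    field_simp
  have hpt : ∀ v, Tendsto (fun n => P n v) atTop (nhds (Z⁻¹ * q v)) := fun v => by
    have := (key' v).add (hRl.mul_const (q v))
    rw [zero_add] at this
    refine this.congr fun n => ?_
    ring
  have hπ : HasSum (fun v => Z⁻¹ * q v) 1 := by
    have := hq.mul_left Z⁻¹
    rwa [inv_mul_cancel₀ hZ0.ne'] at this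
  have hπ0 : ∀ v, 0 ≤ Z⁻¹ * q v := fun v => mul_nonneg (by positivity) (hq0 v)
  set π : ℕ × ℕ × ℕ → ℝ := fun v => Z⁻¹ * q v with hπd
  have hdom : Tendsto (fun n => ∑' v, max (π v - P n v) 0) atTop (nhds (∑' _ : ℕ × ℕ × ℕ, (0:ℝ))) := by
    refine tendsto_tsum_of_dominated_convergence hπ.summable (fun v => ?_) ?_
    · have := ((tendsto_const_nhds (x := π v)).sub (hpt v)).max (tendsto_const_nhds (x := (0:ℝ)))
      simpa [hπd] using this
    · refine Eventually.of_forall fun n v => ?_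
      rw [Real.norm_eq_abs, abs_of_nonneg (le_max_right _ _)]
      exact max_le (by linarith [hnn n v]) (hπ0 v)
  rw [tsum_zero] at hdom
  have := hdom.const_mul 2
  rw [mul_zero] at this
  refine this.congr fun n => ?_
  have hs : Summable (fun v => max (π v - P n v) 0) :=
    Summable.of_nonneg_of_le (fun v => le_max_right _ _)
      (fun v => max_le (by linarith [hnn n v]) (hπ0 v)) hπ.summable
  have hh := (hs.hasSum.mul_left 2).add ((hsum n).sub hπ)
  rw [sub_self, add_zero] at hh
  rw [← hh.tsum_eq]
  refine tsum_congr fun v => ?_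
  show _ = |P n v - π v|
  rcases le_total (π v) (P n v) with h | h
  · rw [max_eq_right (by linarith), abs_of_nonneg (by linarith)]; ring
  · rw [max_eq_left (by linarith), abs_of_nonpos (by linarith)]; ring

end Analytic

section Assembly

lemma div_bound {M k w' F w e O : ℝ} (hM : 0 < M) (hO : 0 < O)
    (h : |M * (k * w') - F * w| ≤ F * (e * O)) :
    |k * (w' / O) - F / M * (w / O)| ≤ F / M * e := by
  have e1 : k * (w' / O) - F / M * (w / O) = (M * (k * w') - F * w) / (M * O) := by
    field_simp
  have e2 : F / M * e = F * (e * O) / (M * O) := by field_simp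
  rw [e1, e2, abs_div, abs_of_pos (mul_pos hM hO)]
  exact div_le_div_of_nonneg_right h (mul_pos hM hO).le

/-- the three statistics -/
noncomputable def Tr {n : ℕ} {d : Fin n → ℕ} (H : SimpleGraph (Fin n)) (σ : HE d → HE d) :
    ℕ × ℕ × ℕ := (Lcount σ, Mcount H σ, Ncount H σ)

lemma W_sum {n : ℕ} {d : Fin n → ℕ} (H : SimpleGraph (Fin n)) (v : ℕ × ℕ × ℕ) :
    ((fl (Om d) (W H v.1 v.2.1 v.2.2)).card : ℝ) = ∑ σ ∈ Om d, ind (Tr H σ = v) := by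
  have h0 : ∑ σ ∈ Om d, ind (Tr H σ = v) = (fl (Om d) (fun σ => Tr H σ = v)).card := by
    unfold ind; convert sum_fl (fun σ => Tr H σ = v) (Om d)
  rw [h0]
  have : (fun σ : HE d → HE d => Tr H σ = v) = W H v.1 v.2.1 v.2.2 := by
    funext σ
    obtain ⟨a, b, c⟩ := v
    simp [Tr, W]
  rw [this]

/-- the law of the three statistics -/
noncomputable def law {n : ℕ} (H : SimpleGraph (Fin n)) (d : Fin n → ℕ) (v : ℕ × ℕ × ℕ) : ℝ :=
  ((fl (Om d) (W H v.1 v.2.1 v.2.2)).card : ℝ) / (Om d).card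

lemma law_nonneg {n : ℕ} (H : SimpleGraph (Fin n)) (d : Fin n → ℕ) (v) : 0 ≤ law H d v := by
  unfold law; positivity

lemma law_hasSum {n : ℕ} (H : SimpleGraph (Fin n)) (d : Fin n → ℕ) (h0 : 0 < (Om d).card) :
    HasSum (law H d) 1 := by
  have h0' : (0:ℝ) < (Om d).card := by exact_mod_cast h0
  have h1 : HasSum (fun v => ∑ σ ∈ Om d, ind (Tr H σ = v)) (∑ σ ∈ Om d, (1:ℝ)) := by
    refine hasSum_sum fun σ _ => ?_
    have := hasSum_single (f := fun v => ind (Tr H σ = v)) (Tr H σ)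
      (fun v hv => ind_neg (Ne.symm hv))
    simpa [ind_pos] using this
  have h2 := h1.div_const ((Om d).card : ℝ)
  rw [Finset.sum_const, nsmul_eq_mul, mul_one, div_self h0'.ne'] at h2
  have e : law H d = fun v => (∑ σ ∈ Om d, ind (Tr H σ = v)) / ((Om d).card : ℝ) := by
    funext v
    rw [law, W_sum]
  rw [e]
  exact h2

lemma law_le_one {n : ℕ} (H : SimpleGraph (Fin n)) (d : Fin n → ℕ) (h0 : 0 < (Om d).card) (v) :
    law H d v ≤ 1 := le_hasSum (law_hasSum H d h0) v (fun w _ => law_nonneg H d w)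

lemma law_tight {n : ℕ} (H : SimpleGraph (Fin n)) (d : Fin n → ℕ) (h0 : 0 < (Om d).card)
    (B : ℕ) (hB : 0 < B) {C : ℝ}
    (hC : ∑ σ ∈ Om d, ((Lcount σ : ℝ) + Mcount H σ + Ncount H σ) ≤ C * (Om d).card) :
    1 - C / B ≤ ∑ v ∈ Finset.range B ×ˢ (Finset.range B ×ˢ Finset.range B), law H d v := by
  have h0' : (0:ℝ) < (Om d).card := by exact_mod_cast h0
  have hB' : (0:ℝ) < B := by exact_mod_cast hB
  unfold law
  rw [← Finset.sum_div, le_div_iff₀ h0']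
  simp only [W_sum]
  rw [Finset.sum_comm]
  have key : ∀ σ ∈ Om d, 1 - ((Lcount σ : ℝ) + Mcount H σ + Ncount H σ) / B ≤
      ∑ v ∈ Finset.range B ×ˢ (Finset.range B ×ˢ Finset.range B), ind (Tr H σ = v) := by
    intro σ _
    by_cases h : Tr H σ ∈ Finset.range B ×ˢ (Finset.range B ×ˢ Finset.range B)
    · have h1 := Finset.single_le_sum (f := fun v => ind (Tr H σ = v))
        (fun v _ => ind_nonneg _) h
      rw [ind_pos rfl] at h1
      refine le_trans ?_ h1
      have : 0 ≤ ((Lcount σ : ℝ) + Mcount H σ + Ncount H σ) / B := by positivity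
      linarith
    · refine le_trans ?_ (Finset.sum_nonneg fun v _ => ind_nonneg _)
      rw [sub_nonpos, one_le_div hB']
      have : B ≤ Lcount σ + Mcount H σ + Ncount H σ := by
        by_contra hlt
        apply h
        simp only [Tr, Finset.mem_product, Finset.mem_range]
        omega
      exact_mod_cast this
  refine le_trans ?_ (Finset.sum_le_sum key)
  rw [Finset.sum_sub_distrib, ← Finset.sum_div, Finset.sum_const, nsmul_eq_mul, mul_one]
  have := div_le_div_of_nonneg_right hC hB'.le
  have e : C * (Om d).card / B = C / B * (Om d).card := by ring
  linarith

end Assembly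
theorem final
    (hseq : (n : ℕ) → SimpleGraph (Fin n))
    (hmaxdeg : ∀ ε : ℝ, 0 < ε → ∀ᶠ n in atTop, ∀ v : Fin n,
      (Nat.card {w : Fin n // (hseq n).Adj v w} : ℝ) ≤ ε * n)
    (dseq : (n : ℕ) → Fin n → ℕ)
    (heven : ∀ n, Even (∑ i, dseq n i))
    (p : ℕ → ℝ) (hpnn : ∀ k, 0 ≤ p k) (hp1 : HasSum p 1) (hp0 : p 0 < 1)
    (μ2 : ℝ) (hμ2 : HasSum (fun k : ℕ => (k : ℝ) ^ 2 * p k) μ2)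
    (hpconv : ∀ k : ℕ, Tendsto
      (fun n => (Nat.card {i : Fin n // dseq n i = k} : ℝ) / n) atTop (nhds (p k)))
    (hμ2conv : Tendsto (fun n => (∑ i, (dseq n i : ℝ) ^ 2) / n) atTop (nhds μ2))
    (A : ℝ)
    (hηconv : Tendsto (fun n =>
      (∑ x : Fin n × Fin n, if (hseq n).Adj x.1 x.2 then
          (dseq n x.1 : ℝ) * (dseq n x.2) else 0) / (2 * n))
      atTop (nhds A)) :
    Tendsto (fun n => ∑' v : ℕ × ℕ × ℕ, |law (hseq n) (dseq n) v
          - poiP ((μ2 / mu1 p - 1) / 2) v.1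
            * poiP ((μ2 / mu1 p - 1) ^ 2 / 4) v.2.1
            * poiP (A / mu1 p) v.2.2|)
      atTop (nhds 0) := by
  have hOm : ∀ n, 0 < (Om (dseq n)).card := fun n => Om_pos (heven n)
  have hμ0 : 0 ≤ μ2 := hμ2.nonneg fun k => mul_nonneg (by positivity) (hpnn k)
  have hκ := mu1_pos hpnn hp1 hp0 hμ2
  have hm := sumdeg_lim hpnn hpconv hμ2 hμ2conv
  obtain ⟨D, hD, hD0, hD1, hD2⟩ := maxdeg_lim hpconv hμ2 hμ2conv
  obtain ⟨S, hS, hS0, hS1⟩ := nbr_lim (dseq := dseq) hmaxdeg hμ0 hμ2conv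
  set m : ℕ → ℝ := fun n => (Fintype.card (HE (dseq n)) : ℝ) with hmd
  have hmeq : ∀ n, ∑ i, (dseq n i : ℝ) = m n := fun n => card_HE.symm
  simp only [hmeq] at hm
  set e : ℕ → ℝ := fun n => epsT (m n) (D n) (S n) (∑ i, (dseq n i : ℝ) ^ 2) (m n - 7) with he
  have hel : Tendsto e atTop (nhds 0) := epsT_lim hκ hD1 hD2 hS1 hμ2conv hm (sub_const_lim 7 hm)
  have h7 : ∀ᶠ n in atTop, 7 < m n := by
    have h1 : Tendsto (fun n : ℕ => m n / n * n) atTop atTop :=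
      hm.pos_mul_atTop hκ tendsto_natCast_atTop_atTop
    filter_upwards [h1.eventually_gt_atTop 7, eventually_gt_atTop 0] with n hn hn0
    have hn0' : (0:ℝ) < n := by exact_mod_cast hn0
    rwa [div_mul_cancel₀ _ hn0'.ne'] at hn
  -- limits of means
  have hLn : Tendsto (fun n => ((fL (dseq n)).card : ℝ) / n) atTop (nhds ((μ2 - mu1 p) / 2)) := by
    refine ((hμ2conv.sub hm).div_const 2).congr fun n => ?_
    have := card_fL (d := dseq n)
    rw [hmeq] at this
    rw [← sub_div, ← this]; ring
  have hNn : Tendsto (fun n => ((fN (hseq n) (dseq n)).card : ℝ) / n) atTop (nhds A) := by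
    refine hηconv.congr fun n => ?_
    rw [← card_fN]; ring
  have hMn : Tendsto (fun n => ((fM (hseq n) (dseq n)).card : ℝ) / (n : ℝ) ^ 2) atTop
      (nhds ((μ2 - mu1 p) ^ 2 / 4)) := by
    have u1 : Tendsto (fun n => (((fL (dseq n)).card : ℝ) / n) ^ 2) atTop
      (nhds ((μ2 - mu1 p) ^ 2 / 4)) := by
      have := hLn.pow 2
      rwa [show ((μ2 - mu1 p) / 2) ^ 2 = (μ2 - mu1 p) ^ 2 / 4 by ring] at this
    have u2 := u1.sub ((hD2.mul (hμ2conv.add (hNn.const_mul 2))).div_const 4)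
    rw [zero_mul, zero_div, sub_zero] at u2
    refine tendsto_of_tendsto_of_tendsto_of_le_of_le u2 u1 (fun n => ?_) (fun n => ?_)
    · have := card_fM_ge (H := hseq n) (hD n)
      have h2 := div_le_div_of_nonneg_right this (show (0:ℝ) ≤ 4 * (n:ℝ) ^ 2 by positivity)
      dsimp only
      refine le_trans (le_of_eq ?_) (h2.trans (le_of_eq ?_)) <;> ring
    · have := card_fM_le (H := hseq n) (d := dseq n)
      have h2 := div_le_div_of_nonneg_right this (show (0:ℝ) ≤ 4 * (n:ℝ) ^ 2 by positivity)
      dsimp only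
      refine le_trans (le_of_eq ?_) (h2.trans (le_of_eq ?_)) <;> ring
  have hm1 := sub_const_lim 1 hm
  have hm3 := sub_const_lim 3 hm
  have lL : Tendsto (fun n => ((fL (dseq n)).card : ℝ) / (m n - 1)) atTop
      (nhds ((μ2 / mu1 p - 1) / 2)) := by
    have := ratio_lim hκ hLn hm1
    rwa [show (μ2 - mu1 p) / 2 / mu1 p = (μ2 / mu1 p - 1) / 2 by field_simp] at this
  have lN : Tendsto (fun n => ((fN (hseq n) (dseq n)).card : ℝ) / (m n - 1)) atTop
      (nhds (A / mu1 p)) := ratio_lim hκ hNn hm1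
  have lM : Tendsto (fun n => ((fM (hseq n) (dseq n)).card : ℝ) / ((m n - 1) * (m n - 3))) atTop
      (nhds ((μ2 / mu1 p - 1) ^ 2 / 4)) := by
    have := hMn.div (hm1.mul hm3) (mul_pos hκ hκ).ne'
    rw [show (μ2 - mu1 p) ^ 2 / 4 / (mu1 p * mu1 p) = (μ2 / mu1 p - 1) ^ 2 / 4 by field_simp] at this
    refine lim_congr_pos this fun n hn => ?_
    rw [Pi.div_apply]
    field_simp
  have pos1 : ∀ᶠ n in atTop, 0 < m n - 1 := h7.mono fun n hn => by linarith
  have pos2 : ∀ᶠ n in atTop, 0 < (m n - 1) * (m n - 3) :=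
    h7.mono fun n hn => mul_pos (by linarith) (by linarith)
  have hDB : ∀ᶠ n in atTop, DB (Sigma.fst : HE (dseq n) → Fin n) (hseq n) (D n) (S n)
      (∑ i, (dseq n i : ℝ) ^ 2) (m n - 7) := h7.mono fun n hn => by
    have := mkDB (hD n) (hD0 n) (hS n) (by rw [hmeq]; exact hn)
    rwa [hmeq] at this
  have hO : ∀ n, (0:ℝ) < (Om (dseq n)).card := fun n => by exact_mod_cast hOm n
  refine analytic (fun n => law (hseq n) (dseq n)) (fun n v => law_nonneg _ _ v)
    (fun n => law_hasSum _ _ (hOm n)) ?_ ?_ ?_ (fun a b c => ?_) (fun a b c => ?_) (fun a b c => ?_) ?_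
  · refine ge_of_tendsto lL ?_
    filter_upwards [pos1] with n hn
    positivity
  · positivity
  · refine ge_of_tendsto lN ?_
    filter_upwards [pos1] with n hn
    positivity
  · refine rec_lim lL hel (fun n => law_nonneg _ _ _) (fun n => law_le_one _ _ (hOm n) _) ?_
    filter_upwards [pos1, hDB, eventually_gt_atTop 0] with n h1 h2 h3
    haveI : Nonempty (Fin n) := ⟨⟨0, h3⟩⟩
    exact div_bound h1 (hO n) (stein_L h2 a b c)
  · have hel2 := hel.const_mul 2
    rw [mul_zero] at hel2
    refine rec_lim lM hel2 (fun n => law_nonneg _ _ _) (fun n => law_le_one _ _ (hOm n) _) ?_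
    filter_upwards [pos2, hDB, eventually_gt_atTop 0] with n h1 h2 h3
    haveI : Nonempty (Fin n) := ⟨⟨0, h3⟩⟩
    exact div_bound h1 (hO n) (stein_M h2 a b c)
  · refine rec_lim lN hel (fun n => law_nonneg _ _ _) (fun n => law_le_one _ _ (hOm n) _) ?_
    filter_upwards [pos1, hDB, eventually_gt_atTop 0] with n h1 h2 h3
    haveI : Nonempty (Fin n) := ⟨⟨0, h3⟩⟩
    exact div_bound h1 (hO n) (stein_N h2 a b c)
  · intro ε hε
    have lim := (lL.add lM).add lN
    obtain ⟨C, hC⟩ : ∃ C, C = (μ2 / mu1 p - 1) / 2 + (μ2 / mu1 p - 1) ^ 2 / 4 + A / mu1 p + 1 :=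
      ⟨_, rfl⟩
    have lim' := lim.eventually (gt_mem_nhds (show _ < C by rw [hC]; linarith))
    obtain ⟨B, hB⟩ := exists_nat_gt (max (C / ε) 0)
    have hB0 : (0:ℝ) < B := lt_of_le_of_lt (le_max_right _ _) hB
    have hB1 : C / ε < B := lt_of_le_of_lt (le_max_left _ _) hB
    refine ⟨Finset.range B ×ˢ (Finset.range B ×ˢ Finset.range B), ?_⟩
    filter_upwards [lim', pos1, pos2] with n h1 h2 h3
    have := law_tight (hseq n) (dseq n) (hOm n) B (by exact_mod_cast hB0) (C := C) (by
      rw [Finset.sum_add_distrib, Finset.sum_add_distrib]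
      have a1 := mean_L (d := dseq n)
      have a2 := mean_M (H := hseq n) (d := dseq n)
      have a3 := mean_N (H := hseq n) (d := dseq n)
      have b1 : ∑ σ ∈ Om (dseq n), (Lcount σ : ℝ) =
          ((fL (dseq n)).card : ℝ) / (m n - 1) * (Om (dseq n)).card := by
        rw [div_mul_eq_mul_div, eq_div_iff h2.ne', mul_comm]; exact a1
      have b2 : ∑ σ ∈ Om (dseq n), (Mcount (hseq n) σ : ℝ) =
          ((fM (hseq n) (dseq n)).card : ℝ) / ((m n - 1) * (m n - 3)) * (Om (dseq n)).card := by
        rw [div_mul_eq_mul_div, eq_div_iff h3.ne', mul_comm]; exact a2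
      have b3 : ∑ σ ∈ Om (dseq n), (Ncount (hseq n) σ : ℝ) =
          ((fN (hseq n) (dseq n)).card : ℝ) / (m n - 1) * (Om (dseq n)).card := by
        rw [div_mul_eq_mul_div, eq_div_iff h2.ne', mul_comm]; exact a3
      rw [b1, b2, b3, ← add_mul, ← add_mul]
      exact mul_le_mul_of_nonneg_right h1.le (hO n).le)
    refine le_trans ?_ this
    rw [div_lt_iff₀ hε] at hB1
    have : C / B ≤ ε := by rw [div_le_iff₀ hB0]; linarith
    linarith

/-- Poisson approximation for graph superpositions: under the standing assumptions,
with `G_n = CM(dⁿ)` (a uniformly random pairing of half-edges), `L_n = L(G_n)`,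
`M_n = M(G_n, h_n)`, `N_n = N(G_n, h_n)`, the total variation distance between the law
of `(L_n, M_n, N_n)` and `Poi(ν/2) ⊗ Poi(ν²/4) ⊗ Poi(η)` tends to `0`, where
`ν = μ₂(p)/μ₁(p) − 1` and `η = (1/μ₁(p)) ∑_{i,j} ij α(i,j)`.  (For discrete laws, the
total variation distance is half the `ℓ¹` distance of the mass functions.) -/
theorem poisson_approximation
    (hseq : (n : ℕ) → SimpleGraph (Fin n))
    (hmaxdeg : ∀ ε : ℝ, 0 < ε → ∀ᶠ n in atTop, ∀ v : Fin n,
      (Nat.card {w : Fin n // (hseq n).Adj v w} : ℝ) ≤ ε * n)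
    (dseq : (n : ℕ) → Fin n → ℕ)
    (heven : ∀ n, Even (∑ i, dseq n i))
    (p : ℕ → ℝ) (hpnn : ∀ k, 0 ≤ p k) (hp1 : HasSum p 1) (hp0 : p 0 < 1)
    (μ2 : ℝ) (hμ2 : HasSum (fun k : ℕ => (k : ℝ) ^ 2 * p k) μ2)
    (hpconv : ∀ k : ℕ, Tendsto
      (fun n => (Nat.card {i : Fin n // dseq n i = k} : ℝ) / n) atTop (nhds (p k)))
    (hμ2conv : Tendsto (fun n => (∑ i, (dseq n i : ℝ) ^ 2) / n) atTop (nhds μ2))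
    (α : ℕ → ℕ → ℝ) (hαnn : ∀ a b, 0 ≤ α a b)
    (hαconv : ∀ a b : ℕ, Tendsto (fun n =>
      (Nat.card {x : Fin n × Fin n //
          (hseq n).Adj x.1 x.2 ∧ dseq n x.1 = a ∧ dseq n x.2 = b} : ℝ) / (2 * n))
      atTop (nhds (α a b)))
    (A : ℝ) (hA : HasSum (fun kl : ℕ × ℕ => (kl.1 : ℝ) * kl.2 * α kl.1 kl.2) A)
    (hηconv : Tendsto (fun n =>
      (∑ x : Fin n × Fin n, if (hseq n).Adj x.1 x.2 then
          (dseq n x.1 : ℝ) * (dseq n x.2) else 0) / (2 * n))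
      atTop (nhds A)) :
    Tendsto (fun n =>
      (1 / 2 : ℝ) * ∑' v : ℕ × ℕ × ℕ,
        |(Nat.card {M : HE (dseq n) → HE (dseq n) // IsMatching M ∧
              Lcount M = v.1 ∧ Mcount (hseq n) M = v.2.1 ∧ Ncount (hseq n) M = v.2.2} : ℝ)
            / (Nat.card {M : HE (dseq n) → HE (dseq n) // IsMatching M} : ℝ)
          - poiP ((μ2 / mu1 p - 1) / 2) v.1
            * poiP ((μ2 / mu1 p - 1) ^ 2 / 4) v.2.1
            * poiP (A / mu1 p) v.2.2|)
      atTop (nhds 0) := by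
  have h := (final hseq hmaxdeg dseq heven p hpnn hp1 hp0 μ2 hμ2 hpconv hμ2conv A hηconv).const_mul
    (1 / 2 : ℝ)
  rw [mul_zero] at h
  refine h.congr fun n => ?_
  have e1 : ∀ v : ℕ × ℕ × ℕ, law (hseq n) (dseq n) v =
      (Nat.card {M : HE (dseq n) → HE (dseq n) // IsMatching M ∧
              Lcount M = v.1 ∧ Mcount (hseq n) M = v.2.1 ∧ Ncount (hseq n) M = v.2.2} : ℝ)
            / (Nat.card {M : HE (dseq n) → HE (dseq n) // IsMatching M} : ℝ) := by
    intro v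
    rw [card_fl_univ, card_fl_univ, law, Om, fl_fl]
    rfl
  simp only [e1]


end TWG
end

section
/- For any integer b ≥ 1 there exists n₀ such that for all n ≥ n₀ the following holds. Let d = (d(1),…,d(n)) be a degree sequence with d(i) ≥ 1 for all i ∈ [n] and ∑_{i=1}^n d(i) ≥ 2n−1, set S = ⋃_{i=1}^n {i1,…,i(d(i)−1)} and s = |S|. Let U be a uniformly random subset of S with |U| = n−1, and for 1 ≤ i ≤ n write U_i = #{1 ≤ j < d(i) : (i,j) ∈ U}. For 0 ≤ a < b, write P_{b,a} = #{1 ≤ i ≤ n : (d(i), U_i) = (b,a)}. Then for all ε > 0, P(|P_{b,a} − E[P_{b,a}]| > ε·E[P_{b,a}]) < (1/ε²)·(1/E[P_{b,a}] + 2b²/s). -/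
open Classical

namespace TWG

lemma count_split {α : Type*} (T : Finset α) (p : α → Prop) [DecidablePred p]
    (m a : ℕ) (ha : a ≤ m) (Q : Finset α → Prop) [DecidablePred Q] :
    ((T.powersetCard m).filter (fun U => (U.filter p).card = a ∧
      Q (U.filter (fun x => ¬ p x)))).card
    = (T.filter p).card.choose a *
      (((T.filter (fun x => ¬ p x)).powersetCard (m - a)).filter Q).card := by
  rw [← Finset.card_powersetCard, ← Finset.card_product]
  refine Finset.card_bij' (fun U _ => (U.filter p, U.filter (fun x => ¬ p x)))
    (fun V _ => V.1 ∪ V.2) ?_ ?_ ?_ ?_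
  · intro U hU
    simp only [Finset.mem_filter, Finset.mem_powersetCard, Finset.mem_product] at hU ⊢
    obtain ⟨⟨h1, h2⟩, h3, h4⟩ := hU
    have := Finset.card_filter_add_card_filter_not (s := U) p
    refine ⟨⟨Finset.filter_subset_filter _ h1, h3⟩,
      ⟨Finset.filter_subset_filter _ h1, by omega⟩, h4⟩
  · rintro ⟨V, W⟩ hV
    simp only [Finset.mem_filter, Finset.mem_powersetCard, Finset.mem_product] at hV ⊢
    obtain ⟨⟨h1, h2⟩, ⟨h3, h4⟩, h5⟩ := hV
    have e1 : (V ∪ W).filter p = V := by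
      ext x
      have := @h1 x
      have := @h3 x
      simp only [Finset.mem_filter, Finset.mem_union] at *
      tauto
    have e2 : (V ∪ W).filter (fun x => ¬ p x) = W := by
      ext x
      have := @h1 x
      have := @h3 x
      simp only [Finset.mem_filter, Finset.mem_union] at *
      tauto
    have := Finset.card_filter_add_card_filter_not (s := V ∪ W) p
    rw [e1, e2] at this ⊢
    refine ⟨⟨Finset.union_subset (h1.trans (Finset.filter_subset _ _))
      (h3.trans (Finset.filter_subset _ _)), by omega⟩, h2, h5⟩
  · intro U hU
    exact Finset.filter_union_filter_not_eq _ _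
  · rintro ⟨V, W⟩ hV
    simp only [Finset.mem_filter, Finset.mem_powersetCard, Finset.mem_product] at hV ⊢
    obtain ⟨⟨h1, h2⟩, ⟨h3, h4⟩, h5⟩ := hV
    ext x
    · have := @h1 x
      have := @h3 x
      simp only [Finset.mem_filter, Finset.mem_union] at *
      tauto
    · have := @h1 x
      have := @h3 x
      simp only [Finset.mem_filter, Finset.mem_union] at *
      tauto

lemma count_one {α : Type*} (T : Finset α) (p : α → Prop) [DecidablePred p]
    (m a : ℕ) (ha : a ≤ m) :
    ((T.powersetCard m).filter (fun U => (U.filter p).card = a)).card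
    = (T.filter p).card.choose a * (T.card - (T.filter p).card).choose (m - a) := by
  have h := count_split T p m a ha (fun _ => True)
  have := Finset.card_filter_add_card_filter_not (s := T) p
  simp only [and_true, Finset.filter_true, Finset.card_powersetCard] at h
  rw [h]
  congr 2
  omega

lemma count_two {α : Type*} (T : Finset α) (p q : α → Prop)
    [DecidablePred p] [DecidablePred q] (hpq : ∀ x, q x → ¬ p x)
    (m a : ℕ) (ha : 2 * a ≤ m) :
    ((T.powersetCard m).filter (fun U => (U.filter p).card = a ∧ (U.filter q).card = a)).card
    = (T.filter p).card.choose a * ((T.filter q).card.choose a *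
      (T.card - (T.filter p).card - (T.filter q).card).choose (m - 2 * a)) := by
  have e : ∀ U : Finset α, (U.filter (fun x => ¬ p x)).filter q = U.filter q := by
    intro U
    ext x
    have := hpq x
    simp only [Finset.mem_filter]
    tauto
  have h := count_split T p m a (by omega) (fun V => (V.filter q).card = a)
  have := Finset.card_filter_add_card_filter_not (s := T) p
  rw [count_one _ _ _ _ (by omega)] at h
  simp only [e] at h
  rw [h]
  congr 3
  · omega
  · omega

lemma asc_mono (k x y : ℕ) (h : x ≤ y) : x.ascFactorial k ≤ y.ascFactorial k := by
  induction k with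
  | zero => simp
  | succ k ih =>
    rw [Nat.ascFactorial_succ, Nat.ascFactorial_succ]
    gcongr

lemma fact_convex (x c : ℕ) : (x + c).factorial ^ 2 ≤ (x + 2 * c).factorial * x.factorial := by
  have h1 := Nat.factorial_mul_ascFactorial x c
  have h2 := Nat.factorial_mul_ascFactorial (x + c) c
  have h3 : (x + 1).ascFactorial c ≤ (x + c + 1).ascFactorial c :=
    asc_mono c _ _ (by omega)
  rw [show x + 2 * c = x + c + c by ring, ← h2, sq]
  nth_rewrite 2 [← h1]
  calc _ ≤ (x + c).factorial * (x.factorial * (x + c + 1).ascFactorial c) := by gcongr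
    _ = _ := by ring

lemma asc_bound (y e k : ℕ) :
    (y + e + 1).ascFactorial k * (y + 1) ^ k ≤ (y + 1 + e) ^ k * (y + 1).ascFactorial k := by
  induction k with
  | zero => simp
  | succ k ih =>
    rw [Nat.ascFactorial_succ, Nat.ascFactorial_succ, pow_succ, pow_succ]
    have h : (y + e + 1 + k) * (y + 1) ≤ (y + 1 + e) * (y + 1 + k) := by nlinarith
    calc _ = ((y + e + 1 + k) * (y + 1)) * ((y + e + 1).ascFactorial k * (y + 1) ^ k) := by ring
      _ ≤ ((y + 1 + e) * (y + 1 + k)) * ((y + 1 + e) ^ k * (y + 1).ascFactorial k) := by gcongr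
      _ = _ := by ring

lemma pow_bound (y e : ℕ) (h1 : 4 * e ≤ y) (h2 : 4 * e ^ 2 ≤ y) :
    (1 + (e : ℝ) / (y + 1)) ^ e ≤ 1 + 2 * ((e : ℝ) + 1) ^ 2 / (y + 2 * e) := by
  have hy : (0 : ℝ) < y + 1 := by positivity
  rcases Nat.eq_zero_or_pos e with rfl | he
  · simp; positivity
  have he' : (1 : ℝ) ≤ e := by exact_mod_cast he
  have h1' : 4 * (e : ℝ) ≤ y := by exact_mod_cast h1
  have h2' : 4 * (e : ℝ) ^ 2 ≤ y := by exact_mod_cast h2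
  set t : ℝ := (e : ℝ) ^ 2 / (y + 1) with ht
  have ht0 : 0 ≤ t := by positivity
  have ht1 : t ≤ 1 / 4 := by
    rw [ht, div_le_iff₀ hy]; linarith
  have hexp : (1 + (e : ℝ) / (y + 1)) ^ e ≤ Real.exp t := by
    have : 1 + (e : ℝ) / (y + 1) ≤ Real.exp ((e : ℝ) / (y + 1)) := by
      have := Real.add_one_le_exp ((e : ℝ) / (y + 1)); linarith
    calc _ ≤ (Real.exp ((e : ℝ) / (y + 1))) ^ e := by gcongr
      _ = Real.exp t := by rw [← Real.exp_nat_mul, ht]; congr 1; ring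
  have hq := Real.abs_exp_sub_one_sub_id_le (x := t) (by rw [abs_of_nonneg ht0]; linarith)
  have hq' := (abs_le.mp hq).2
  have h5 : t + t ^ 2 ≤ 5 / 4 * t := by nlinarith
  have h6 : 5 / 4 * t ≤ 2 * ((e : ℝ) + 1) ^ 2 / (y + 2 * e) := by
    rw [ht, le_div_iff₀ (by positivity), mul_div_assoc', div_mul_eq_mul_div, div_le_iff₀ hy]
    have : 5 / 4 * ((y : ℝ) + 2 * e) ≤ 2 * (y + 1) := by linarith
    calc _ = (e : ℝ) ^ 2 * (5 / 4 * ((y : ℝ) + 2 * e)) := by ring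
      _ ≤ ((e : ℝ) + 1) ^ 2 * (2 * (y + 1)) := by gcongr; linarith
      _ = _ := by ring
  linarith

lemma fact_upper (y e : ℕ) (h1 : 4 * e ≤ y) (h2 : 4 * e ^ 2 ≤ y) :
    ((y + 2 * e).factorial : ℝ) * y.factorial ≤
      (1 + 2 * ((e : ℝ) + 1) ^ 2 / (y + 2 * e)) * (y + e).factorial ^ 2 := by
  have a1 := Nat.factorial_mul_ascFactorial y e
  have a2 := Nat.factorial_mul_ascFactorial (y + e) e
  have a3 := asc_bound y e e
  have a4 := pow_bound y e h1 h2
  have hy : (0 : ℝ) < y + 1 := by positivity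
  have a3' : ((y + e + 1).ascFactorial e : ℝ) ≤
      (1 + (e : ℝ) / (y + 1)) ^ e * (y + 1).ascFactorial e := by
    have a3r : ((y + e + 1).ascFactorial e : ℝ) * ((y : ℝ) + 1) ^ e ≤
      ((y : ℝ) + 1 + e) ^ e * (y + 1).ascFactorial e := by exact_mod_cast a3
    have : 1 + (e : ℝ) / (y + 1) = (y + 1 + e) / (y + 1) := by field_simp
    rw [this, div_pow, div_mul_eq_mul_div, le_div_iff₀ (by positivity)]
    exact a3r
  have a1r : ((y + e).factorial : ℝ) = y.factorial * (y + 1).ascFactorial e := by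
    exact_mod_cast a1.symm
  have a2r : ((y + 2 * e).factorial : ℝ) = (y + e).factorial * (y + e + 1).ascFactorial e := by
    rw [show y + 2 * e = y + e + e by ring]; exact_mod_cast a2.symm
  have a5 := a3'.trans (mul_le_mul_of_nonneg_right a4 (Nat.cast_nonneg _))
  have a6 : ((y + e).factorial : ℝ) ^ 2 =
      (y + e).factorial * (y.factorial * (y + 1).ascFactorial e) := by rw [← a1r, sq]
  rw [a2r, a6]
  calc _ = ((y + e).factorial : ℝ) * y.factorial * (y + e + 1).ascFactorial e := by ring
    _ ≤ ((y + e).factorial : ℝ) * y.factorial * _ := mul_le_mul_of_nonneg_left a5 (by positivity)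
    _ = _ := by ring

lemma choose_fact (x y : ℕ) :
    (x + y).choose x * x.factorial * y.factorial = (x + y).factorial := by
  have := Nat.choose_mul_factorial_mul_factorial (Nat.le_add_right x y)
  rwa [Nat.add_sub_cancel_left] at this

lemma choose_bound (s m e a : ℕ) (hae : a ≤ e) (hms : m ≤ s) (ham : 2 * a ≤ m)
    (h1 : 6 * e ≤ s) (h2 : 4 * e ^ 2 + 2 * e ≤ s) :
    ((s - 2 * e).choose (m - 2 * a) : ℝ) * s.choose m ≤
      (1 + 2 * ((e : ℝ) + 1) ^ 2 / s) * ((s - e).choose (m - a)) ^ 2 := by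
  by_cases hr : s - m < 2 * (e - a)
  · rw [Nat.choose_eq_zero_of_lt (by omega)]
    simp; positivity
  obtain ⟨c, rfl⟩ := Nat.exists_eq_add_of_le hae
  obtain ⟨μ, rfl⟩ := Nat.exists_eq_add_of_le ham
  obtain ⟨ρ, hρ⟩ : ∃ ρ, s = μ + ρ + 2 * (a + c) := ⟨s - 2 * (a + c) - μ, by omega⟩
  have e1 : s - 2 * (a + c) = μ + ρ := by omega
  have e2 : s - (a + c) = (μ + a) + (ρ + c) := by omega
  have e3 : s = (μ + 2 * a) + (ρ + 2 * c) := by omega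
  have b := fact_upper (μ + ρ) (a + c) (by omega) (by omega)
  have hs : ((μ + ρ : ℕ) : ℝ) + 2 * ((a + c : ℕ) : ℝ) = s := by rw [hρ]; push_cast; ring
  rw [hs] at b
  set K : ℝ := 1 + 2 * (((a + c : ℕ) : ℝ) + 1) ^ 2 / s with hK
  have hK0 : 0 ≤ K := by positivity
  rw [e1, e2, show 2 * a + μ - 2 * a = μ by omega, show 2 * a + μ - a = μ + a by omega,
    show 2 * a + μ = μ + 2 * a by ring]
  rw [show μ + ρ + 2 * (a + c) = (μ + 2 * a) + (ρ + 2 * c) by ring,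
    show μ + ρ + (a + c) = (μ + a) + (ρ + c) by ring] at b
  have c1 : (((μ + ρ).choose μ : ℕ) : ℝ) * μ.factorial * ρ.factorial = (μ + ρ).factorial := by
    exact_mod_cast choose_fact μ ρ
  have c2 : ((((μ + a) + (ρ + c)).choose (μ + a) : ℕ) : ℝ) * (μ + a).factorial * (ρ + c).factorial
      = ((μ + a) + (ρ + c)).factorial := by
    exact_mod_cast choose_fact (μ + a) (ρ + c)
  have c3 : ((s.choose (μ + 2 * a) : ℕ) : ℝ) * (μ + 2 * a).factorial * (ρ + 2 * c).factorial
      = ((μ + 2 * a) + (ρ + 2 * c)).factorial := by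
    rw [e3]
    exact_mod_cast choose_fact (μ + 2 * a) (ρ + 2 * c)
  have f1 : ((μ + a).factorial : ℝ) ^ 2 ≤ (μ + 2 * a).factorial * μ.factorial := by
    exact_mod_cast fact_convex μ a
  have f2 : ((ρ + c).factorial : ℝ) ^ 2 ≤ (ρ + 2 * c).factorial * ρ.factorial := by
    exact_mod_cast fact_convex ρ c
  rw [← c1, ← c2, ← c3] at b
  set x : ℝ := (((μ + ρ).choose μ : ℕ) : ℝ)
  set y : ℝ := ((((μ + a) + (ρ + c)).choose (μ + a) : ℕ) : ℝ)
  set z : ℝ := ((s.choose (μ + 2 * a) : ℕ) : ℝ)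
  have p1 : (0 : ℝ) < (μ + 2 * a).factorial * μ.factorial := by positivity
  have p2 : (0 : ℝ) < (ρ + 2 * c).factorial * ρ.factorial := by positivity
  refine le_of_mul_le_mul_right (a := ((μ + 2 * a).factorial * μ.factorial : ℝ) *
    ((ρ + 2 * c).factorial * ρ.factorial)) ?_ (mul_pos p1 p2)
  calc _ ≤ K * y ^ 2 * (((μ + a).factorial : ℝ) ^ 2 * ((ρ + c).factorial : ℝ) ^ 2) := by
        nlinarith [b]
    _ ≤ _ := by gcongr

/-- Chebyshev in finite counting form. -/
lemma cheb {β : Type*} (V : Finset β) (X : β → ℝ) (t E : ℝ) (ht : 0 ≤ t)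
    (hE : ∑ U ∈ V, X U = E * V.card) :
    ((V.filter (fun U => t < |X U - E|)).card : ℝ) * t ^ 2 ≤
      ∑ U ∈ V, X U ^ 2 - E ^ 2 * V.card := by
  have h1 : ∑ U ∈ V, (X U - E) ^ 2 = ∑ U ∈ V, X U ^ 2 - E ^ 2 * V.card := by
    simp only [sub_sq, Finset.sum_add_distrib, Finset.sum_sub_distrib, Finset.sum_const,
      nsmul_eq_mul, ← Finset.sum_mul, ← Finset.mul_sum, hE]
    ring
  rw [← h1, ← nsmul_eq_mul, ← Finset.sum_const]
  calc _ ≤ ∑ U ∈ V.filter (fun U => t < |X U - E|), (X U - E) ^ 2 := by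
        refine Finset.sum_le_sum fun U hU => ?_
        rw [← sq_abs (X U - E)]
        have := (Finset.mem_filter.mp hU).2
        gcongr
    _ ≤ _ := Finset.sum_le_sum_of_subset_of_nonneg (Finset.filter_subset _ _)
        fun _ _ _ => sq_nonneg _

lemma moments {β ι : Type*} (V : Finset β) (I : Finset ι) (R : β → ι → Prop) (N1 N2 : ℕ)
    (h1 : ∀ i ∈ I, (V.filter (fun U => R U i)).card = N1)
    (h2 : ∀ i ∈ I, ∀ j ∈ I, i ≠ j → (V.filter (fun U => R U i ∧ R U j)).card = N2) :
    (∑ U ∈ V, ((I.filter (R U)).card : ℝ) = I.card * N1) ∧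
    (∑ U ∈ V, ((I.filter (R U)).card : ℝ) ^ 2 =
      I.card * N1 + I.card * ((I.card : ℝ) - 1) * N2) := by
  have hX : ∀ U, ((I.filter (R U)).card : ℝ) = ∑ i ∈ I, if R U i then (1 : ℝ) else 0 := by
    intro U
    simp
  constructor
  · simp only [hX]
    rw [Finset.sum_comm]
    rw [← nsmul_eq_mul, ← Finset.sum_const]
    refine Finset.sum_congr rfl fun i hi => ?_
    rw [← h1 i hi]; simp
  · simp only [hX, sq, Finset.sum_mul_sum]
    rw [Finset.sum_comm]
    have : ∀ i ∈ I, (∑ U ∈ V, ∑ j ∈ I, (if R U i then (1 : ℝ) else 0) * (if R U j then 1 else 0))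
        = N1 + ((I.card : ℝ) - 1) * N2 := by
      intro i hi
      rw [Finset.sum_comm, ← Finset.add_sum_erase I _ hi]
      congr 1
      · rw [← h1 i hi, Finset.card_filter]; push_cast
        refine Finset.sum_congr rfl fun U _ => ?_
        split_ifs <;> simp
      · have hc : ((I.card : ℝ) - 1) = ((I.erase i).card : ℝ) := by
          rw [← Finset.card_erase_add_one hi]; push_cast; ring
        rw [hc, ← nsmul_eq_mul, ← Finset.sum_const]
        refine Finset.sum_congr rfl fun j hj => ?_
        rw [← h2 i hi j (Finset.mem_of_mem_erase hj) (Finset.ne_of_mem_erase hj).symm]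
        rw [Finset.card_filter]; push_cast
        refine Finset.sum_congr rfl fun U _ => ?_
        by_cases hh1 : R U i <;> by_cases hh2 : R U j <;> simp [hh1, hh2]
    rw [Finset.sum_congr rfl this]
    simp; ring

lemma final_bound {β : Type*} (V : Finset β) (X : β → ℕ) (K N1 N2 : ℕ) (δ ε EP : ℝ)
    (hUpos : (0 : ℝ) < V.card) (hδ : 0 < δ) (hε : 0 < ε)
    (m1 : ∑ U ∈ V, (X U : ℝ) = K * N1)
    (m2 : ∑ U ∈ V, (X U : ℝ) ^ 2 = K * N1 + K * ((K : ℝ) - 1) * N2)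
    (cb' : (N2 : ℝ) * V.card ≤ (1 + δ) * N1 ^ 2)
    (hE : EP = (∑ U ∈ V, (X U : ℝ)) / V.card) :
    ((V.filter (fun U => ε * EP < |(X U : ℝ) - EP|)).card : ℝ) / V.card
       < ε⁻¹ ^ 2 * (1 / EP + δ) := by
  have hEPdef : EP = K * N1 / V.card := by rw [hE, m1]
  have hEPmul : ∑ U ∈ V, (X U : ℝ) = EP * V.card := by rw [hE]; field_simp
  have hEP0 : 0 ≤ EP := by
    rw [hEPdef]
    exact div_nonneg (mul_nonneg (Nat.cast_nonneg _) (Nat.cast_nonneg _)) hUpos.le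
  rcases hEP0.eq_or_lt with h0 | hpos
  · have hz : ∀ U ∈ V, (X U : ℝ) = 0 := by
      rw [← h0, zero_mul] at hEPmul
      exact (Finset.sum_eq_zero_iff_of_nonneg fun _ _ => Nat.cast_nonneg _).mp hEPmul
    have hemp : V.filter (fun U => ε * EP < |(X U : ℝ) - EP|) = ∅ := by
      refine Finset.filter_eq_empty_iff.mpr fun U hU => ?_
      rw [hz U hU, ← h0]; simp
    rw [hemp, ← h0]
    simp only [Finset.card_empty, Nat.cast_zero, zero_div, div_zero, zero_add]
    positivity
  · have hc := cheb V (fun U => (X U : ℝ)) (ε * EP) EP (by positivity) hEPmul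
    rw [m2] at hc
    set F : ℝ := ((V.filter (fun U => ε * EP < |(X U : ℝ) - EP|)).card : ℝ) with hF
    set k : ℝ := (K : ℝ)
    set N : ℝ := (V.card : ℝ)
    have hkN : k * N1 = EP * N := by rw [hEPdef]; field_simp
    have hkN0 : 0 < k * (N1 : ℝ) := by rw [hkN]; exact mul_pos hpos hUpos
    have hk0 : 0 < k := pos_of_mul_pos_left hkN0 (Nat.cast_nonneg _)
    have hN10 : (0 : ℝ) < N1 := pos_of_mul_pos_right hkN0 hk0.le
    have hk1 : 1 ≤ k := by
      have : 0 < K := by simpa [k] using hk0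
      simp only [k]; exact_mod_cast this
    have key : k * (k - 1) * N2 < (1 + δ) * EP ^ 2 * N := by
      refine lt_of_mul_lt_mul_right (a := N) ?_ hUpos.le
      calc _ = k * (k - 1) * (N2 * N) := by ring
        _ ≤ k * (k - 1) * ((1 + δ) * N1 ^ 2) := by
          apply mul_le_mul_of_nonneg_left cb'
          exact mul_nonneg hk0.le (by linarith)
        _ < k * k * ((1 + δ) * N1 ^ 2) := by
          have : 0 < (1 + δ) * (N1 : ℝ) ^ 2 := by positivity
          nlinarith [mul_pos hk0 this]
        _ = (1 + δ) * (k * N1) ^ 2 := by ring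
        _ = _ := by rw [hkN]; ring
    have hfin : F * (ε * EP) ^ 2 < EP * N + δ * EP ^ 2 * N := by
      rw [hkN] at hc
      linarith
    have hrw : ε⁻¹ ^ 2 * (1 / EP + δ) = (EP * N + δ * EP ^ 2 * N) / (ε * EP) ^ 2 / N := by
      field_simp
    rw [hrw]
    refine div_lt_div_of_pos_right ?_ hUpos
    rw [lt_div_iff₀ (by positivity)]
    exact hfin

/-- Concentration for degrees under subsampling: for `b ≥ 1` and all `n` large
enough (depending only on `b`), for any degree sequence `d` with `d i ≥ 1` and
`∑ d i ≥ 2n − 1`, letting `U` be a uniformly random `(n-1)`-element subset of the set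
`S = ⋃_i {i1, …, i(d(i)−1)}` (of size `s = ∑ (d i − 1)`), and
`P_{b,a} = #{i : d i = b, U_i = a}` where `U_i = #(U ∩ {i1, …, i(d(i)−1)})`, one has
`P(|P_{b,a} − E P_{b,a}| > ε E P_{b,a}) < ε⁻² (1/E P_{b,a} + 2b²/s)` for all `ε > 0`
and all `0 ≤ a < b`. -/
theorem subset_degree_concentration (b : ℕ) (hb : 1 ≤ b) :
    ∃ n₀ : ℕ, ∀ n : ℕ, n₀ ≤ n → ∀ d : Fin n → ℕ, (∀ i, 1 ≤ d i) →
    2 * n - 1 ≤ ∑ i, d i → ∀ a : ℕ, a < b → ∀ ε : ℝ, 0 < ε →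
    (let 𝒰 : Finset (Finset ((i : Fin n) × Fin (d i - 1))) :=
        Finset.powersetCard (n - 1) Finset.univ
     let P : Finset ((i : Fin n) × Fin (d i - 1)) → ℕ := fun U =>
        (Finset.univ.filter (fun i : Fin n =>
          d i = b ∧ (U.filter (fun h => h.1 = i)).card = a)).card
     let EP : ℝ := (∑ U ∈ 𝒰, (P U : ℝ)) / 𝒰.card
     ((𝒰.filter (fun U => ε * EP < |(P U : ℝ) - EP|)).card : ℝ) / 𝒰.card
       < ε⁻¹ ^ 2 * (1 / EP + 2 * (b : ℝ) ^ 2 / (∑ i, (d i - 1) : ℕ))) := by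
  obtain ⟨e, rfl⟩ := Nat.exists_eq_add_of_le' hb
  refine ⟨4 * e ^ 2 + 6 * e + 10, ?_⟩
  intro n hn d hd hsum a ha ε hε 𝒰 P EP
  set s : ℕ := ∑ i, (d i - 1) with hs
  have hsn : n - 1 ≤ s := by
    have : s + n = ∑ i, d i := by
      have h0 : ∑ i : Fin n, (d i - 1 + 1) = ∑ i, d i :=
        Finset.sum_congr rfl fun i _ => Nat.sub_add_cancel (hd i)
      rw [Finset.sum_add_distrib] at h0
      simpa using h0
    omega
  have hcard : (Finset.univ : Finset ((i : Fin n) × Fin (d i - 1))).card = s := by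
    simp [hs]
  have hs0 : (0 : ℝ) < s := by
    have : 0 < s := by omega
    exact_mod_cast this
  have hUcard : 𝒰.card = s.choose (n - 1) := by
    simp only [𝒰, Finset.card_powersetCard, hcard]
  have hUpos : (0 : ℝ) < 𝒰.card := by
    rw [hUcard]; exact_mod_cast Nat.choose_pos hsn
  set I : Finset (Fin n) := Finset.univ.filter (fun i => d i = e + 1) with hI
  obtain ⟨R, hR⟩ : ∃ R : Finset ((i : Fin n) × Fin (d i - 1)) → Fin n → Prop,
    ∀ U i, R U i ↔ (U.filter (fun h => h.1 = i)).card = a := ⟨_, fun _ _ => Iff.rfl⟩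
  have hP : ∀ U, P U = (I.filter (R U)).card := by
    intro U
    simp only [P, hI, hR, Finset.filter_filter]
  have hfib : ∀ i ∈ I, ((Finset.univ : Finset ((i : Fin n) × Fin (d i - 1))).filter
      (fun h => h.1 = i)).card = e := by
    intro i hi
    have hdi : d i = e + 1 := (Finset.mem_filter.mp hi).2
    have : (Finset.univ : Finset ((i : Fin n) × Fin (d i - 1))).filter (fun h => h.1 = i)
        = (Finset.univ : Finset (Fin (d i - 1))).map (Function.Embedding.sigmaMk i) := by
      ext ⟨j, x⟩
      simp only [Finset.mem_filter, Finset.mem_univ, true_and, Finset.mem_map,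
        Function.Embedding.sigmaMk_apply]
      constructor
      · rintro rfl; exact ⟨x, rfl⟩
      · rintro ⟨y, hy⟩; exact (congrArg Sigma.fst hy).symm
    rw [this, Finset.card_map, Finset.card_univ, Fintype.card_fin, hdi]; rfl
  set N1 : ℕ := e.choose a * (s - e).choose (n - 1 - a) with hN1
  set N2 : ℕ := e.choose a * (e.choose a * (s - 2 * e).choose (n - 1 - 2 * a)) with hN2
  have h1 : ∀ i ∈ I, (𝒰.filter (fun U => R U i)).card = N1 := by
    intro i hi
    have := count_one (Finset.univ : Finset ((i : Fin n) × Fin (d i - 1)))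
      (fun h => h.1 = i) (n - 1) a (by omega)
    rw [hcard, hfib i hi] at this
    simp only [hR, 𝒰, hN1]
    rw [← this]
  have h2 : ∀ i ∈ I, ∀ j ∈ I, i ≠ j → (𝒰.filter (fun U => R U i ∧ R U j)).card = N2 := by
    intro i hi j hj hij
    have := count_two (Finset.univ : Finset ((i : Fin n) × Fin (d i - 1)))
      (fun h => h.1 = i) (fun h => h.1 = j) (fun x hx hx' => hij (hx'.symm.trans hx))
      (n - 1) a (by omega)
    rw [hcard, hfib i hi, hfib j hj, Nat.sub_sub, ← two_mul e] at this
    simp only [hR, 𝒰, hN2]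
    rw [← this]
  obtain ⟨m1, m2⟩ := moments 𝒰 I R N1 N2 h1 h2
  simp only [← hP] at m1 m2
  have hδ : (0 : ℝ) < 2 * ((e + 1 : ℕ) : ℝ) ^ 2 / s := by
    have : (0 : ℝ) < ((e + 1 : ℕ) : ℝ) := by exact_mod_cast Nat.succ_pos e
    exact div_pos (mul_pos two_pos (pow_pos this 2)) hs0
  have cb := choose_bound s (n - 1) e a (by omega) hsn (by omega) (by omega) (by omega)
  refine final_bound 𝒰 P I.card N1 N2 _ ε EP hUpos hδ hε m1 m2 ?_ rfl
  rw [hUcard, hN1, hN2]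
  push_cast
  calc _ = ((e.choose a : ℕ) : ℝ) ^ 2 *
        (((s - 2 * e).choose (n - 1 - 2 * a) : ℝ) * s.choose (n - 1)) := by ring
    _ ≤ ((e.choose a : ℕ) : ℝ) ^ 2 * _ := mul_le_mul_of_nonneg_left cb (sq_nonneg _)
    _ = _ := by ring

end TWG
end
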